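/- Let p be a prime with p ≡ 9 (mod 16), k = ℚ(√p), F the unique quartic subfield of ℚ(μ_p), and ε a unit of the ring of integers of k with ε > 0 and N_{k/ℚ}(ε) = −1. Then the class number of F(√ε) is odd. -/

import Mathlib

set_option maxHeartbeats 1000000
set_option synthInstance.maxHeartbeats 400000

open NumberField IntermediateField

theorem LinearMap.finrank_range_add_finrank_ker_int {M N : Type*} [AddCommGroup M] [AddCommGroup N]
    [Module.Finite ℤ M] (f : M →ₗ[ℤ] N) :
    Module.finrank ℤ f.range + Module.finrank ℤ f.ker = Module.finrank ℤ M := by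
  rw [← f.quotKerEquivRange.finrank_eq]
  exact f.ker.finrank_quotient_add_finrank

theorem AddSubgroup.index_range_nsmul_of_finite {T : Type*} [AddCommGroup T] [Finite T] (n : ℕ) :
    (nsmulAddMonoidHom n : T →+ T).range.index = Nat.card (nsmulAddMonoidHom n : T →+ T).ker := by
  have h1 := (nsmulAddMonoidHom n : T →+ T).range.card_mul_index
  have h2 := (nsmulAddMonoidHom n : T →+ T).ker.card_mul_index
  rw [AddSubgroup.index_ker] at h2
  have h3 : 0 < Nat.card (nsmulAddMonoidHom n : T →+ T).range := Nat.card_pos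
  nlinarith

theorem AddSubgroup.index_range_two_nsmul_int_pi (n : ℕ) :
    (nsmulAddMonoidHom 2 : (Fin n →₀ ℤ) →+ (Fin n →₀ ℤ)).range.index = 2 ^ n := by
  let f : (Fin n →₀ ℤ) →+ (Fin n →₀ ZMod 2) :=
    Finsupp.mapRange.addMonoidHom (Int.castAddHom (ZMod 2))
  have hf : Function.Surjective f :=
    Finsupp.mapRange_surjective _ (by simp) (ZMod.intCast_surjective)
  have hk : (nsmulAddMonoidHom 2 : (Fin n →₀ ℤ) →+ (Fin n →₀ ℤ)).range = f.ker := by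
    ext x
    rw [AddMonoidHom.mem_ker, AddMonoidHom.mem_range]
    constructor
    · rintro ⟨y, rfl⟩
      ext i
      have : (2 : ZMod 2) = 0 := rfl
      simp [f, this]
    · intro h
      have h1 : ∀ i, ∃ y : ℤ, x i = 2 * y := by
        intro i
        have := DFunLike.congr_fun h i
        simp only [f, Finsupp.mapRange.addMonoidHom_apply, Finsupp.mapRange_apply,
          Int.coe_castAddHom, Finsupp.coe_zero, Pi.zero_apply] at this
        exact (ZMod.intCast_zmod_eq_zero_iff_dvd _ 2).1 this
      choose y hy using h1
      refine ⟨Finsupp.equivFunOnFinite.symm y, ?_⟩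
      ext i
      simp [hy i]
  rw [hk, AddSubgroup.index_ker, AddMonoidHom.range_eq_top.2 hf,
    Nat.card_congr AddSubgroup.topEquiv.toEquiv,
    Nat.card_congr Finsupp.equivFunOnFinite]
  simp

theorem AddSubgroup.index_range_two_nsmul {A : Type*} [AddCommGroup A] [Module.Finite ℤ A] :
    (nsmulAddMonoidHom 2 : A →+ A).range.index =
      2 ^ Module.finrank ℤ A * Nat.card (nsmulAddMonoidHom 2 : A →+ A).ker := by
  have : AddGroup.FG A := Module.Finite.iff_addGroup_fg.mp inferInstance
  obtain ⟨n, ι, _, p, hp, e, ⟨f⟩⟩ := AddCommGroup.equiv_free_prod_directSum_zmod A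
  set T := DirectSum ι fun i => ZMod (p i ^ e i)
  have : ∀ i, NeZero (p i ^ e i) := fun i => ⟨pow_ne_zero _ (hp i).ne_zero⟩
  have : Finite T :=
    Finite.of_equiv _ (DirectSum.addEquivProd fun i => ZMod (p i ^ e i)).symm.toEquiv
  have hrank : Module.finrank ℤ A = n := by
    have hT : Module.finrank ℤ T = 0 := by
      rw [Module.finrank_eq_zero_iff_isTorsion]
      intro x
      refine ⟨⟨Nat.card T, by simpa using Nat.card_pos.ne'⟩, ?_⟩
      simp
    rw [f.toIntLinearEquiv.finrank_eq]
    have hfree : Module.finrank ℤ ((Fin n →₀ ℤ) × T) = Module.finrank ℤ (Fin n →₀ ℤ) := by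
      have h := LinearMap.finrank_range_add_finrank_ker_int (LinearMap.fst ℤ (Fin n →₀ ℤ) T)
      have h3 : Module.finrank ℤ (LinearMap.fst ℤ (Fin n →₀ ℤ) T).ker = Module.finrank ℤ T := by
        rw [LinearMap.ker_fst]
        exact (LinearMap.finrank_range_of_inj LinearMap.inr_injective)
      rw [LinearMap.range_eq_top.2 LinearMap.fst_surjective, finrank_top, h3, hT] at h
      omega
    rw [hfree]
    simp
  have hr : (nsmulAddMonoidHom 2 : A →+ A).range.index =
      (nsmulAddMonoidHom 2 : (Fin n →₀ ℤ) × T →+ (Fin n →₀ ℤ) × T).range.index := by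
    rw [← AddSubgroup.index_map_equiv _ f]
    congr 1
    ext x
    simp only [AddSubgroup.mem_map, AddMonoidHom.mem_range]
    constructor
    · rintro ⟨_, ⟨y, rfl⟩, rfl⟩
      exact ⟨f y, by simp⟩
    · rintro ⟨y, rfl⟩
      exact ⟨_, ⟨f.symm y, rfl⟩, by simp⟩
  have hp : (nsmulAddMonoidHom 2 : (Fin n →₀ ℤ) × T →+ (Fin n →₀ ℤ) × T).range =
      (nsmulAddMonoidHom 2 : (Fin n →₀ ℤ) →+ (Fin n →₀ ℤ)).range.prod
        (nsmulAddMonoidHom 2 : T →+ T).range := by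
    ext ⟨x, y⟩
    simp [AddSubgroup.mem_prod, Prod.ext_iff]
  have hk : Nat.card (nsmulAddMonoidHom 2 : A →+ A).ker =
      Nat.card (nsmulAddMonoidHom 2 : T →+ T).ker := by
    symm
    refine Nat.card_congr (Equiv.ofBijective
      (fun t => ⟨f.symm (0, t.1), ?_⟩) ⟨?_, ?_⟩)
    · have := t.2
      rw [AddMonoidHom.mem_ker, nsmulAddMonoidHom_apply] at this ⊢
      rw [← map_nsmul, Prod.smul_mk, this]
      simp
    · rintro ⟨a, ha⟩ ⟨b, hb⟩ h
      simpa using h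
    · rintro ⟨a, ha⟩
      have h1 : 2 • f a = 0 := by
        rw [AddMonoidHom.mem_ker, nsmulAddMonoidHom_apply] at ha
        rw [← map_nsmul, ha, map_zero]
      have h2 : (f a).1 = 0 := by
        have := congrArg Prod.fst h1
        simpa using this
      refine ⟨⟨(f a).2, ?_⟩, ?_⟩
      · have := congrArg Prod.snd h1
        simpa using this
      · ext
        simp only
        rw [AddEquiv.symm_apply_eq, ← h2]
  rw [hr, hp, AddSubgroup.index_prod, AddSubgroup.index_range_two_nsmul_int_pi,
    AddSubgroup.index_range_nsmul_of_finite, hrank, hk]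

theorem relIndex_map_pow_two {A : Type*} [CommGroup A] [Module.Finite ℤ (Additive A)]
    (H : Subgroup A) {e : A} (he : e ∈ H) (he1 : e ≠ 1) (he2 : ∀ a : A, a ^ 2 = 1 ↔ a = 1 ∨ a = e) :
    (H.map (powMonoidHom 2)).relIndex H = 2 ^ Module.finrank ℤ (Additive H) * 2 := by
  have hfin : Module.Finite ℤ (Additive H) :=
    inferInstanceAs (Module.Finite ℤ (AddSubgroup.toIntSubmodule (Subgroup.toAddSubgroup H)))
  have h1 : (H.map (powMonoidHom 2)).subgroupOf H = (powMonoidHom 2 : H →* H).range := by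
    ext x
    simp only [Subgroup.mem_subgroupOf, Subgroup.mem_map, MonoidHom.mem_range, powMonoidHom_apply]
    constructor
    · rintro ⟨y, hy, h⟩
      exact ⟨⟨y, hy⟩, Subtype.ext h⟩
    · rintro ⟨y, rfl⟩
      exact ⟨y, y.2, rfl⟩
  have h2 := AddSubgroup.index_range_two_nsmul (A := Additive H)
  have h3 : Nat.card (nsmulAddMonoidHom 2 : Additive H →+ Additive H).ker = 2 := by
    rw [Nat.card_eq_two_iff]
    refine ⟨0, ⟨Additive.ofMul ⟨e, he⟩, ?_⟩, ?_, ?_⟩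
    · rw [AddMonoidHom.mem_ker, nsmulAddMonoidHom_apply, ← ofMul_pow]
      have : (⟨e, he⟩ : H) ^ 2 = 1 := Subtype.ext ((he2 e).2 (Or.inr rfl))
      rw [this]; rfl
    · intro h
      apply he1
      have := congrArg (fun x => ((Additive.toMul x.1 : H) : A)) h
      exact this.symm
    · rw [Set.eq_univ_iff_forall]
      rintro ⟨x, hx⟩
      rw [AddMonoidHom.mem_ker, nsmulAddMonoidHom_apply] at hx
      have hx' : ((Additive.toMul x : H) : A) ^ 2 = 1 :=
        congrArg (fun x => ((Additive.toMul x : H) : A)) hx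
      rcases (he2 _).1 hx' with h | h
      · left; ext; exact h
      · right; ext; exact h
  rw [h3] at h2
  rw [Subgroup.relIndex, h1, ← h2]
  rfl

/-- Comparison of the two Tate cohomology groups of a finitely generated abelian group, for a pair
of endomorphisms `N`, `D` playing the roles of `1 + σ` and `1 - σ`. -/
theorem relIndex_range_ker_mul {A : Type*} [CommGroup A] [Module.Finite ℤ (Additive A)]
    (N D : A →* A) (hND : ∀ a, N (D a) = 1) (hDN : ∀ a, D (N a) = 1)
    (hsq : ∀ a, a ^ 2 = N a * D a)
    {e : A} (heN : N e = 1) (heD : D e = 1) (he1 : e ≠ 1)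
    (he2 : ∀ a : A, a ^ 2 = 1 ↔ a = 1 ∨ a = e) :
    N.range.relIndex D.ker * 2 ^ Module.finrank ℤ (Additive N.ker) =
      D.range.relIndex N.ker * 2 ^ Module.finrank ℤ (Additive D.ker) := by
  have hN : D.ker.map N = D.ker.map (powMonoidHom 2) := by
    ext x
    simp only [Subgroup.mem_map, powMonoidHom_apply]
    exact exists_congr fun a => and_congr_right fun ha => by
      rw [hsq, MonoidHom.mem_ker.1 ha, mul_one]
  have hD : N.ker.map D = N.ker.map (powMonoidHom 2) := by
    ext x
    simp only [Subgroup.mem_map, powMonoidHom_apply]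
    exact exists_congr fun a => and_congr_right fun ha => by
      rw [hsq, MonoidHom.mem_ker.1 ha, one_mul]
  have h1 : (D.ker.map N).relIndex N.range = (D.ker ⊔ N.ker).index := by
    rw [← Subgroup.index_comap, Subgroup.comap_map_eq]
  have h2 : (N.ker.map D).relIndex D.range = (D.ker ⊔ N.ker).index := by
    rw [← Subgroup.index_comap, Subgroup.comap_map_eq, sup_comm]
  have h3 := Subgroup.relIndex_mul_relIndex (D.ker.map N) N.range D.ker
    (Subgroup.map_le_range _ _) (by rintro _ ⟨a, rfl⟩; exact hDN a)
  have h4 := Subgroup.relIndex_mul_relIndex (N.ker.map D) D.range N.ker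
    (Subgroup.map_le_range _ _) (by rintro _ ⟨a, rfl⟩; exact hND a)
  rw [h1, hN, relIndex_map_pow_two _ heD he1 he2] at h3
  rw [h2, hD, relIndex_map_pow_two _ heN he1 he2] at h4
  have h0 : (D.ker ⊔ N.ker).index ≠ 0 := by
    intro h
    rw [h, zero_mul] at h3
    simp at h3
  apply mul_left_cancel₀ (mul_ne_zero h0 two_ne_zero)
  calc _ = ((D.ker ⊔ N.ker).index * N.range.relIndex D.ker) *
        (2 ^ Module.finrank ℤ (Additive N.ker) * 2) := by ring
    _ = ((D.ker ⊔ N.ker).index * D.range.relIndex N.ker) *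
        (2 ^ Module.finrank ℤ (Additive D.ker) * 2) := by rw [h3, h4]; ring
    _ = _ := by ring

theorem finrank_ker_add_finrank_ker {A : Type*} [CommGroup A] [Module.Finite ℤ (Additive A)]
    (N D : A →* A) (hDN : ∀ a, D (N a) = 1) (hsq : ∀ a, a ^ 2 = N a * D a) :
    Module.finrank ℤ (Additive N.ker) + Module.finrank ℤ (Additive D.ker) =
      Module.finrank ℤ (Additive A) := by
  let n : Additive A →ₗ[ℤ] Additive A := (MonoidHom.toAdditive N).toIntLinearMap
  let d : Additive A →ₗ[ℤ] Additive A := (MonoidHom.toAdditive D).toIntLinearMap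
  have hn : Module.finrank ℤ (Additive N.ker) = Module.finrank ℤ n.ker := rfl
  have hd : Module.finrank ℤ (Additive D.ker) = Module.finrank ℤ d.ker := rfl
  rw [hn, hd, ← n.finrank_range_add_finrank_ker_int, add_comm]
  congr 1
  apply le_antisymm
  · let g : d.ker →ₗ[ℤ] n.range := LinearMap.codRestrict _ (n.domRestrict d.ker) (fun x => ⟨x, rfl⟩)
    have hg : Module.finrank ℤ g.ker = 0 := by
      rw [Module.finrank_eq_zero_iff_isTorsion]
      rintro ⟨⟨x, hx⟩, hx'⟩
      refine ⟨⟨2, by simp⟩, ?_⟩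
      have h1 : D (Additive.toMul x) = 1 := hx
      have h2 : N (Additive.toMul x) = 1 := congrArg Subtype.val (LinearMap.mem_ker.1 hx')
      have h3 : Additive.toMul x ^ 2 = 1 := by rw [hsq, h1, h2, one_mul]
      ext
      have h4 : (2 : ℤ) • x = 0 := by
        rw [two_zsmul, ← two_nsmul]
        exact h3
      exact h4
    have := g.finrank_range_add_finrank_ker_int
    rw [hg] at this
    rw [← this, add_zero]
    exact Submodule.finrank_le _
  · apply Submodule.finrank_mono
    rintro _ ⟨x, rfl⟩
    exact hDN (Additive.toMul x)

section Quadratic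

variable {K L : Type*} [Field K] [Field L] [Algebra K L]

/-- The automorphism of the ring of integers induced by an automorphism of the field. -/
noncomputable def ringOfIntegersConj (σ : L ≃ₐ[K] L) : 𝓞 L ≃+* 𝓞 L :=
  RingOfIntegers.mapRingEquiv σ.toRingEquiv

@[simp]
theorem coe_ringOfIntegersConj (σ : L ≃ₐ[K] L) (x : 𝓞 L) :
    (ringOfIntegersConj σ x : L) = σ x := rfl

@[simp]
theorem ringOfIntegersConj_algebraMap (σ : L ≃ₐ[K] L) (x : 𝓞 K) :
    ringOfIntegersConj σ (algebraMap (𝓞 K) (𝓞 L) x) = algebraMap (𝓞 K) (𝓞 L) x := by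
  ext
  exact σ.commutes x

variable [NumberField K] [NumberField L]

theorem eq_one_or_eq_of_finrank_eq_two (h2 : Module.finrank K L = 2) {σ : L ≃ₐ[K] L} (hσ : σ ≠ 1)
    (g : L ≃ₐ[K] L) : g = 1 ∨ g = σ := by
  have : Algebra.IsQuadraticExtension K L := ⟨h2⟩
  have hc : Nat.card (L ≃ₐ[K] L) = 2 := by rw [IsGalois.card_aut_eq_finrank, h2]
  obtain ⟨y, hy, hu⟩ := Nat.card_eq_two_iff' (1 : L ≃ₐ[K] L) |>.1 hc
  by_cases hg : g = 1
  · exact Or.inl hg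
  · exact Or.inr ((hu g hg).trans (hu σ hσ).symm)

theorem mul_self_eq_one_of_finrank_eq_two (h2 : Module.finrank K L = 2) {σ : L ≃ₐ[K] L}
    (hσ : σ ≠ 1) : σ * σ = 1 := by
  rcases eq_one_or_eq_of_finrank_eq_two h2 hσ (σ * σ) with h | h
  · exact h
  · exact absurd (mul_eq_left.1 h) hσ

theorem ringOfIntegersConj_conj (h2 : Module.finrank K L = 2) {σ : L ≃ₐ[K] L} (hσ : σ ≠ 1)
    (x : 𝓞 L) : ringOfIntegersConj σ (ringOfIntegersConj σ x) = x := by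
  ext
  exact DFunLike.congr_fun (mul_self_eq_one_of_finrank_eq_two h2 hσ) (x : L)

theorem algebraNorm_eq_mul_of_finrank_eq_two (h2 : Module.finrank K L = 2) {σ : L ≃ₐ[K] L}
    (hσ : σ ≠ 1) (x : L) : algebraMap K L (Algebra.norm K x) = x * σ x := by
  have : Algebra.IsQuadraticExtension K L := ⟨h2⟩
  classical
  rw [Algebra.norm_eq_prod_automorphisms]
  have huniv : (Finset.univ : Finset (L ≃ₐ[K] L)) = {1, σ} := by
    ext g
    simpa using eq_one_or_eq_of_finrank_eq_two h2 hσ g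
  rw [huniv, Finset.prod_pair hσ.symm]
  rfl

omit [NumberField K] [NumberField L] in
theorem exists_algebraMap_eq_of_forall_conj_eq [IsGalois K L] [FiniteDimensional K L] {x : 𝓞 L}
    (hx : ∀ g : L ≃ₐ[K] L, ringOfIntegersConj g x = x) :
    ∃ y : 𝓞 K, algebraMap (𝓞 K) (𝓞 L) y = x := by
  obtain ⟨y, hy⟩ := (IsGalois.mem_range_algebraMap_iff_fixed (F := K) (x : L)).2
    fun g => congrArg (algebraMap (𝓞 L) L) (hx g)
  have h_int : IsIntegral ℤ y := by
    have := RingOfIntegers.isIntegral_coe x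
    change IsIntegral ℤ (x : L) at this
    rw [← hy] at this
    exact (isIntegral_algebraMap_iff (algebraMap K L).injective).1 this
  exact ⟨⟨y, h_int⟩, RingOfIntegers.ext hy⟩

theorem exists_algebraMap_eq_of_conj_eq (h2 : Module.finrank K L = 2) {σ : L ≃ₐ[K] L}
    (hσ : σ ≠ 1) {x : 𝓞 L} (hx : ringOfIntegersConj σ x = x) :
    ∃ y : 𝓞 K, algebraMap (𝓞 K) (𝓞 L) y = x := by
  have : Algebra.IsQuadraticExtension K L := ⟨h2⟩
  refine exists_algebraMap_eq_of_forall_conj_eq fun g => ?_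
  rcases eq_one_or_eq_of_finrank_eq_two h2 hσ g with rfl | rfl
  · rfl
  · exact hx

theorem algebraMap_intNorm_eq (h2 : Module.finrank K L = 2) {σ : L ≃ₐ[K] L}
    (hσ : σ ≠ 1) (x : 𝓞 L) :
    algebraMap (𝓞 K) (𝓞 L) (Algebra.intNorm (𝓞 K) (𝓞 L) x) = x * ringOfIntegersConj σ x := by
  ext
  change _ = (x : L) * σ x
  rw [← algebraNorm_eq_mul_of_finrank_eq_two h2 hσ]
  have := Algebra.algebraMap_intNorm (A := 𝓞 K) (K := K) (L := L) (B := 𝓞 L) x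
  rw [← this]
  rfl

theorem map_relNorm_eq (h2 : Module.finrank K L = 2) {σ : L ≃ₐ[K] L}
    (hσ : σ ≠ 1) (I : Ideal (𝓞 L)) :
    (Ideal.relNorm (𝓞 K) I).map (algebraMap (𝓞 K) (𝓞 L)) = I * I.map (ringOfIntegersConj σ) := by
  by_cases hI : I = ⊥
  · subst hI; simp
  have hle : (Ideal.relNorm (𝓞 K) I).map (algebraMap (𝓞 K) (𝓞 L)) ≤
      I * I.map (ringOfIntegersConj σ) := by
    rw [Ideal.relNorm_apply, Ideal.map_span, Ideal.span_le]
    rintro _ ⟨_, ⟨x, hx, rfl⟩, rfl⟩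
    rw [algebraMap_intNorm_eq h2 hσ]
    exact Ideal.mul_mem_mul hx (Ideal.mem_map_of_mem _ hx)
  obtain ⟨J, hJ⟩ := Ideal.dvd_iff_le.2 hle
  have hn : Ideal.absNorm (I.map (ringOfIntegersConj σ)) = Ideal.absNorm I := by
    rw [← Ideal.comap_symm, Ideal.absNorm_apply, Ideal.absNorm_apply, Submodule.cardQuot_apply,
      Submodule.cardQuot_apply]
    exact (Nat.card_congr (Ideal.quotientEquiv I _ (ringOfIntegersConj σ)
      (Ideal.comap_symm (ringOfIntegersConj σ))).toEquiv).symm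
  have h3 := congrArg Ideal.absNorm hJ
  rw [map_mul, map_mul, hn, Ideal.absNorm_algebraMap, Ideal.absNorm_relNorm] at h3
  have hfr : Module.finrank (𝓞 K) (𝓞 L) = 2 := by
    rw [← h2]
    exact (IsFractionRing.finrank_eq (𝓞 K) K (𝓞 L) L).symm
  rw [hfr] at h3
  have h0 : Ideal.absNorm I ≠ 0 := Ideal.absNorm_eq_zero_iff.not.2 hI
  have hJ1 : Ideal.absNorm J = 1 := by
    apply mul_left_cancel₀ (mul_ne_zero h0 h0)
    rw [← h3]; ring
  rw [Ideal.absNorm_eq_one_iff] at hJ1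
  rw [hJ, hJ1, Ideal.mul_top]

end Quadratic

section Quadratic

variable {K L : Type*} [Field K] [Field L] [Algebra K L]

theorem map_conj_map_algebraMap (σ : L ≃ₐ[K] L) (B : Ideal (𝓞 K)) :
    (B.map (algebraMap (𝓞 K) (𝓞 L))).map (ringOfIntegersConj σ) =
      B.map (algebraMap (𝓞 K) (𝓞 L)) := by
  have h := Ideal.map_map (I := B) (algebraMap (𝓞 K) (𝓞 L))
    (ringOfIntegersConj σ : 𝓞 L →+* 𝓞 L)
  have h1 : (ringOfIntegersConj σ : 𝓞 L →+* 𝓞 L).comp (algebraMap (𝓞 K) (𝓞 L)) =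
      algebraMap (𝓞 K) (𝓞 L) := RingHom.ext (ringOfIntegersConj_algebraMap σ)
  rw [h1] at h
  exact h

theorem map_conj_eq_of_inertia {σ : L ≃ₐ[K] L} {P : Ideal (𝓞 L)} (hP : P.IsMaximal)
    (hin : ∀ x, ringOfIntegersConj σ x - x ∈ P) : P.map (ringOfIntegersConj σ) = P := by
  have hm : (P.map (ringOfIntegersConj σ)).IsMaximal := by
    rw [← Ideal.comap_symm]
    exact Ideal.comap_isMaximal_of_equiv _
  apply hm.eq_of_le hP.ne_top
  rw [Ideal.map_le_iff_le_comap]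
  intro x hx
  have := P.add_mem (hin x) hx
  rwa [sub_add_cancel] at this

variable [NumberField K] [NumberField L]

theorem map_conj_map_conj (h2 : Module.finrank K L = 2) {σ : L ≃ₐ[K] L} (hσ : σ ≠ 1)
    (I : Ideal (𝓞 L)) : (I.map (ringOfIntegersConj σ)).map (ringOfIntegersConj σ) = I := by
  have h := Ideal.map_map (I := I) (ringOfIntegersConj σ : 𝓞 L →+* 𝓞 L)
    (ringOfIntegersConj σ : 𝓞 L →+* 𝓞 L)
  have h1 : (ringOfIntegersConj σ : 𝓞 L →+* 𝓞 L).comp (ringOfIntegersConj σ : 𝓞 L →+* 𝓞 L) =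
      RingHom.id _ := RingHom.ext (ringOfIntegersConj_conj h2 hσ)
  rw [h1, Ideal.map_id] at h
  exact h

theorem eq_of_comap_eq_of_map_conj_eq (h2 : Module.finrank K L = 2) {σ : L ≃ₐ[K] L} (hσ : σ ≠ 1)
    {P Q : Ideal (𝓞 L)} (hP : P.IsMaximal) (hQ : Q.IsMaximal)
    (hcomap : P.comap (algebraMap (𝓞 K) (𝓞 L)) = Q.comap (algebraMap (𝓞 K) (𝓞 L)))
    (hinv : P.map (ringOfIntegersConj σ) = P) : P = Q := by
  have h1 := map_relNorm_eq h2 hσ P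
  rw [hinv] at h1
  have h3 : P * P ≤ Q := by
    rw [← h1, Ideal.map_le_iff_le_comap, ← hcomap]
    exact Ideal.relNorm_le_comap _ _
  have : P ≤ Q := by
    rcases hQ.isPrime.mul_le.1 h3 with h | h <;> exact h
  exact hP.eq_of_le hQ.ne_top this

theorem eq_map_comap_of_not_inertia (h2 : Module.finrank K L = 2) {σ : L ≃ₐ[K] L} (hσ : σ ≠ 1)
    {P : Ideal (𝓞 L)} (hP : P.IsMaximal)
    (hinv : P.map (ringOfIntegersConj σ) = P) (hin : ¬ ∀ x, ringOfIntegersConj σ x - x ∈ P) :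
    P = (P.comap (algebraMap (𝓞 K) (𝓞 L))).map (algebraMap (𝓞 K) (𝓞 L)) := by
  set p := P.comap (algebraMap (𝓞 K) (𝓞 L)) with hp
  have hover : P.LiesOver p := ⟨rfl⟩
  have hpm : p.IsMaximal := Ideal.isMaximal_comap_of_isIntegral_of_isMaximal P
  have hP0 : P ≠ ⊥ := fun h => hin fun x => by
    exfalso
    exact RingOfIntegers.not_isField L (Ring.isField_iff_maximal_bot.2 (h ▸ hP))
  have h1 := map_relNorm_eq h2 hσ P
  have hN := Ideal.absNorm_relNorm (𝓞 K) (𝓞 L) P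
  have hmp : p.map (algebraMap (𝓞 K) (𝓞 L)) ≤ P := Ideal.map_comap_le
  rw [hinv, Ideal.relNorm_eq_pow_of_isMaximal P p, Ideal.map_pow, ← pow_two] at h1
  rw [Ideal.relNorm_eq_pow_of_isMaximal P p] at hN
  obtain ⟨f, hf⟩ : ∃ f, P.inertiaDeg (𝓞 K) = f := ⟨_, rfl⟩
  rw [hf] at h1 hN
  rcases lt_trichotomy f 2 with h | h | h
  · interval_cases f
    · rw [pow_zero] at h1
      have : (1 : Ideal (𝓞 L)) ≤ P := h1 ▸ Ideal.pow_le_self two_ne_zero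
      exact absurd (top_le_iff.1 (by simpa using this)) hP.ne_top
    · exfalso
      apply hin
      have hsurj : ∀ x : 𝓞 L, ∃ y : 𝓞 K, x - algebraMap (𝓞 K) (𝓞 L) y ∈ P := by
        have hp0 : p ≠ ⊥ := fun h0 => RingOfIntegers.not_isField K
          (Ring.isField_iff_maximal_bot.2 (h0 ▸ hpm))
        have := Ideal.finiteQuotientOfFreeOfNeBot P hP0
        have hinj : Function.Injective (Ideal.quotientMap P (algebraMap (𝓞 K) (𝓞 L)) hp.le) :=
          Ideal.quotientMap_injective' hp.ge
        rw [pow_one, Ideal.absNorm_apply, Ideal.absNorm_apply, Submodule.cardQuot_apply,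
          Submodule.cardQuot_apply] at hN
        have hbij := (Nat.bijective_iff_injective_and_card _).2 ⟨hinj, hN⟩
        intro x
        obtain ⟨y, hy⟩ := hbij.2 (Ideal.Quotient.mk P x)
        obtain ⟨y, rfl⟩ := Ideal.Quotient.mk_surjective y
        rw [Ideal.quotientMap_mk] at hy
        exact ⟨y, Ideal.Quotient.eq.1 hy.symm⟩
      intro x
      obtain ⟨y, hy⟩ := hsurj x
      have hy2 : ringOfIntegersConj σ x - algebraMap (𝓞 K) (𝓞 L) y ∈ P := by
        have := Ideal.mem_map_of_mem (ringOfIntegersConj σ) hy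
        rwa [hinv, map_sub, ringOfIntegersConj_algebraMap] at this
      have := P.sub_mem hy2 hy
      rwa [sub_sub_sub_cancel_right] at this
  · subst h
    exact (pow_left_injective two_ne_zero h1).symm
  · exfalso
    have h3 : P ^ 2 ≤ P ^ 3 := by
      rw [← h1]
      exact (Ideal.pow_le_pow_right h).trans (Ideal.pow_right_mono hmp 3)
    have h4 := Ideal.pow_succ_lt_pow hP0 2
    exact absurd h3 h4.not_ge

theorem exists_eq_map_mul_prod (h2 : Module.finrank K L = 2) {σ : L ≃ₐ[K] L} (hσ : σ ≠ 1)
    (S : Finset (Ideal (𝓞 L)))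
    (hS : ∀ P : Ideal (𝓞 L), P.IsMaximal → (∀ x, ringOfIntegersConj σ x - x ∈ P) → P ∈ S)
    (I : Ideal (𝓞 L)) (hI : I ≠ ⊥) (hinv : I.map (ringOfIntegersConj σ) = I) :
    ∃ T ⊆ S, ∃ B : Ideal (𝓞 K), B ≠ ⊥ ∧
      I = B.map (algebraMap (𝓞 K) (𝓞 L)) * ∏ P ∈ T, P := by
  classical
  obtain ⟨n, hn⟩ : ∃ n, Ideal.absNorm I = n := ⟨_, rfl⟩
  induction n using Nat.strong_induction_on generalizing I with
  | _ n ih =>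
  by_cases htop : I = ⊤
  · exact ⟨∅, by simp, ⊤, top_ne_bot, by simp [htop, Ideal.map_top]⟩
  obtain ⟨P, hP, hle⟩ := Ideal.exists_le_maximal I htop
  have hP0 : P ≠ ⊥ := fun h => hI (le_bot_iff.1 (h ▸ hle))
  have hlt : ∀ A J : Ideal (𝓞 L), A ≤ P → I = A * J → Ideal.absNorm J < n := by
    intro A J hA hAJ
    have h0 : Ideal.absNorm I ≠ 0 := Ideal.absNorm_eq_zero_iff.not.2 hI
    rw [← hn, hAJ, map_mul] at *
    have hA1 : Ideal.absNorm A ≠ 1 := by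
      rw [Ne, Ideal.absNorm_eq_one_iff]
      rintro rfl
      exact hP.ne_top (top_le_iff.1 hA)
    have := Nat.pos_of_ne_zero (right_ne_zero_of_mul h0)
    have := Nat.pos_of_ne_zero (left_ne_zero_of_mul h0)
    have : 2 ≤ Ideal.absNorm A := by omega
    nlinarith
  have hcancel : ∀ A J : Ideal (𝓞 L), A.map (ringOfIntegersConj σ) = A → I = A * J →
      J ≠ ⊥ ∧ J.map (ringOfIntegersConj σ) = J := by
    intro A J hA hAJ
    have hA0 : A ≠ ⊥ := by rintro rfl; exact hI (by simpa using hAJ)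
    refine ⟨by rintro rfl; exact hI (by simpa using hAJ), ?_⟩
    apply mul_left_cancel₀ (a := A) hA0
    rw [← hAJ]
    nth_rw 1 [← hA]
    rw [← Ideal.map_mul, ← hAJ, hinv]
  have hext : ∀ (A : Ideal (𝓞 K)) (J : Ideal (𝓞 L)), A.map (algebraMap (𝓞 K) (𝓞 L)) ≤ P →
      I = A.map (algebraMap (𝓞 K) (𝓞 L)) * J → ∃ T ⊆ S, ∃ B : Ideal (𝓞 K), B ≠ ⊥ ∧
      I = B.map (algebraMap (𝓞 K) (𝓞 L)) * ∏ P ∈ T, P := by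
    intro A J hA hAJ
    obtain ⟨hJ0, hJ⟩ := hcancel _ J (map_conj_map_algebraMap σ A) hAJ
    obtain ⟨T, hT, B, hB, h⟩ := ih _ (hlt _ J hA hAJ) J hJ0 hJ rfl
    have hA0 : A ≠ ⊥ := by rintro rfl; exact hI (by simpa using hAJ)
    exact ⟨T, hT, A * B, mul_ne_zero hA0 hB, by rw [hAJ, Ideal.map_mul, mul_assoc, ← h]⟩
  by_cases hPinv : P.map (ringOfIntegersConj σ) = P
  · by_cases hin : ∀ x, ringOfIntegersConj σ x - x ∈ P
    · obtain ⟨J, hJ⟩ := Ideal.dvd_iff_le.2 hle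
      obtain ⟨hJ0, hJinv⟩ := hcancel P J hPinv hJ
      obtain ⟨T, hT, B, hB, h⟩ := ih _ (hlt _ J le_rfl hJ) J hJ0 hJinv rfl
      by_cases hPT : P ∈ T
      · refine ⟨T.erase P, (Finset.erase_subset _ _).trans hT, B * Ideal.relNorm (𝓞 K) P,
          mul_ne_zero hB (by simpa using hP0), ?_⟩
        rw [hJ, h, Ideal.map_mul, map_relNorm_eq h2 hσ, hPinv, ← Finset.mul_prod_erase T _ hPT]
        ring
      · refine ⟨insert P T, Finset.insert_subset (hS P hP hin) hT, B, hB, ?_⟩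
        rw [hJ, h, Finset.prod_insert hPT]
        ring
    · have h := eq_map_comap_of_not_inertia h2 hσ hP hPinv hin
      obtain ⟨J, hJ⟩ := Ideal.dvd_iff_le.2 hle
      rw [h] at hJ
      exact hext _ J h.symm.le hJ
  · have hle' : I ≤ P.map (ringOfIntegersConj σ) := hinv ▸ Ideal.map_mono hle
    have hm : (P.map (ringOfIntegersConj σ)).IsMaximal := by
      rw [← Ideal.comap_symm]
      exact Ideal.comap_isMaximal_of_equiv _
    have hcop : P ⊔ P.map (ringOfIntegersConj σ) = ⊤ := hP.coprime_of_ne hm (Ne.symm hPinv)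
    have hmul : I ≤ P * P.map (ringOfIntegersConj σ) := by
      rw [Ideal.mul_eq_inf_of_coprime hcop]
      exact le_inf hle hle'
    rw [← map_relNorm_eq h2 hσ] at hmul
    obtain ⟨J, hJ⟩ := Ideal.dvd_iff_le.2 hmul
    refine hext _ J ?_ hJ
    rw [map_relNorm_eq h2 hσ]
    exact Ideal.mul_le_left

end Quadratic

theorem exists_pow_classNumber_eq_span {K : Type*} [Field K] [NumberField K] {I : Ideal (𝓞 K)}
    (hI : I ≠ ⊥) : ∃ b : 𝓞 K, b ≠ 0 ∧ I ^ classNumber K = Ideal.span {b} := by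
  have hmem : I ^ classNumber K ∈ nonZeroDivisors (Ideal (𝓞 K)) :=
    mem_nonZeroDivisors_of_ne_zero (pow_ne_zero _ hI)
  have h1 : ClassGroup.mk0 ⟨I ^ classNumber K, hmem⟩ = 1 := by
    have : (⟨I ^ classNumber K, hmem⟩ : nonZeroDivisors (Ideal (𝓞 K))) =
      ⟨I, mem_nonZeroDivisors_of_ne_zero hI⟩ ^ classNumber K := rfl
    rw [this, map_pow, classNumber, pow_card_eq_one]
  rw [ClassGroup.mk0_eq_one_iff] at h1
  obtain ⟨b, hb⟩ := h1.principal
  refine ⟨b, ?_, hb⟩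
  rintro rfl
  exact pow_ne_zero _ hI (by simpa using hb)

section Quadratic

variable {K L : Type*} [Field K] [Field L] [Algebra K L]

theorem exists_ringOfIntegersConj_ne [NumberField L] {σ : L ≃ₐ[K] L} (hσ : σ ≠ 1) :
    ∃ z : 𝓞 L, ringOfIntegersConj σ z ≠ z := by
  by_contra! h
  apply hσ
  ext x
  obtain ⟨a, b, hb, rfl⟩ := IsFractionRing.div_surjective (A := 𝓞 L) x
  have ha' : σ (algebraMap (𝓞 L) L a) = algebraMap (𝓞 L) L a :=
    congrArg (algebraMap (𝓞 L) L) (h a)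
  have hb' : σ (algebraMap (𝓞 L) L b) = algebraMap (𝓞 L) L b :=
    congrArg (algebraMap (𝓞 L) L) (h b)
  rw [map_div₀, ha', hb', AlgEquiv.one_apply]

variable [NumberField K] [NumberField L]

theorem exists_mul_conj_eq (h2 : Module.finrank K L = 2) {σ : L ≃ₐ[K] L} (hσ : σ ≠ 1)
    {x y : 𝓞 L} (hy : y ≠ 0)
    (hxy : x * ringOfIntegersConj σ x = y * ringOfIntegersConj σ y) :
    ∃ β : 𝓞 L, β ≠ 0 ∧ x * ringOfIntegersConj σ β = y * β := by
  have hy' : ringOfIntegersConj σ y ≠ 0 := by simpa using hy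
  have key : ∀ z, x * ringOfIntegersConj σ (ringOfIntegersConj σ y * (y * z +
      x * ringOfIntegersConj σ z)) = y * (ringOfIntegersConj σ y * (y * z +
      x * ringOfIntegersConj σ z)) := by
    intro z
    simp only [map_mul, map_add, ringOfIntegersConj_conj h2 hσ]
    linear_combination (y * z) * hxy
  by_cases h0 : y + x = 0
  · obtain ⟨z, hz⟩ := exists_ringOfIntegersConj_ne hσ
    refine ⟨_, ?_, key z⟩
    rw [show y * z + x * ringOfIntegersConj σ z = y * (z - ringOfIntegersConj σ z) by
      linear_combination ringOfIntegersConj σ z * h0]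
    exact mul_ne_zero hy' (mul_ne_zero hy (sub_ne_zero.2 hz.symm))
  · refine ⟨_, ?_, key 1⟩
    rw [map_one, mul_one, mul_one]
    exact mul_ne_zero hy' h0

/-- The automorphism of the unit group induced by an automorphism of the field. -/
noncomputable def unitsConj (σ : L ≃ₐ[K] L) : (𝓞 L)ˣ →* (𝓞 L)ˣ :=
  Units.map (ringOfIntegersConj σ : 𝓞 L →* 𝓞 L)

omit [NumberField K] [NumberField L] in
theorem coe_unitsConj (σ : L ≃ₐ[K] L) (a : (𝓞 L)ˣ) :
    (unitsConj σ a : 𝓞 L) = ringOfIntegersConj σ a := rfl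

theorem unitsConj_unitsConj (h2 : Module.finrank K L = 2) {σ : L ≃ₐ[K] L} (hσ : σ ≠ 1)
    (a : (𝓞 L)ˣ) : unitsConj σ (unitsConj σ a) = a :=
  Units.ext (ringOfIntegersConj_conj h2 hσ a)

theorem ker_id_div_unitsConj (h2 : Module.finrank K L = 2) {σ : L ≃ₐ[K] L} (hσ : σ ≠ 1) :
    (MonoidHom.id (𝓞 L)ˣ / unitsConj σ).ker =
      (Units.map (algebraMap (𝓞 K) (𝓞 L) : 𝓞 K →* 𝓞 L)).range := by
  ext a
  rw [MonoidHom.mem_ker, MonoidHom.div_apply, MonoidHom.id_apply, div_eq_one]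
  constructor
  · intro h
    have h1 := congrArg Units.val h
    obtain ⟨y, hy⟩ := exists_algebraMap_eq_of_conj_eq h2 hσ h1.symm
    have h3 : unitsConj σ a⁻¹ = a⁻¹ := by rw [map_inv, ← h]
    obtain ⟨z, hz⟩ := exists_algebraMap_eq_of_conj_eq h2 hσ (congrArg Units.val h3)
    have hinj := FaithfulSMul.algebraMap_injective (𝓞 K) (𝓞 L)
    have hyz : y * z = 1 := hinj (by rw [map_mul, hy, hz, map_one, Units.mul_inv])
    exact ⟨⟨y, z, hyz, by rw [mul_comm, hyz]⟩, Units.ext hy⟩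
  · rintro ⟨u, rfl⟩
    ext
    exact congrArg _ (ringOfIntegersConj_algebraMap σ (u : 𝓞 K)).symm

omit [NumberField L] in
/-- If the ideals generated by the elements `β` and `β'` attached by Hilbert 90 to units
`η` and `η'` of relative norm one differ by ideals of `K`, and `K` has odd class number, then
`η` and `η'` agree modulo units of the form `a / σ a`. -/
theorem div_mem_range_of_mul_map_eq {σ : L ≃ₐ[K] L}
    (hK : Odd (classNumber K)) {η η' : (𝓞 L)ˣ} {β β' : 𝓞 L} (hβ : β ≠ 0)
    (hη : η * ringOfIntegersConj σ β = β) (hη' : η' * ringOfIntegersConj σ β' = β')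
    (hηN : η * unitsConj σ η = 1) (hηN' : η' * unitsConj σ η' = 1)
    {B B' : Ideal (𝓞 K)} (hB : B ≠ ⊥) (hB' : B' ≠ ⊥)
    (h : Ideal.span {β} * B'.map (algebraMap (𝓞 K) (𝓞 L)) =
      Ideal.span {β'} * B.map (algebraMap (𝓞 K) (𝓞 L))) :
    η / η' ∈ (MonoidHom.id (𝓞 L)ˣ / unitsConj σ).range := by
  obtain ⟨b, hb0, hb⟩ := exists_pow_classNumber_eq_span hB
  obtain ⟨b', hb0', hb'⟩ := exists_pow_classNumber_eq_span hB'
  set D := MonoidHom.id (𝓞 L)ˣ / unitsConj σ with hD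
  have hsq : ∀ {a : (𝓞 L)ˣ}, a * unitsConj σ a = 1 → a ^ 2 = D a := by
    intro a ha
    rw [hD, MonoidHom.div_apply, MonoidHom.id_apply, eq_div_iff_mul_eq', pow_two, mul_assoc, ha,
      mul_one]
  obtain ⟨m, hm⟩ := hK
  have h3 := congrArg (· ^ classNumber K) h
  simp only [mul_pow, ← Ideal.map_pow, hb, hb', Ideal.span_singleton_pow, Ideal.map_span,
    Set.image_singleton, Ideal.span_singleton_mul_span_singleton] at h3
  rw [Ideal.span_singleton_eq_span_singleton] at h3
  obtain ⟨v, hv⟩ := h3.symm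
  have hc := congrArg (ringOfIntegersConj σ) hv
  simp only [map_mul, map_pow, ringOfIntegersConj_algebraMap] at hc
  have hne : ringOfIntegersConj σ β ^ classNumber K * algebraMap (𝓞 K) (𝓞 L) b' ≠ 0 :=
    mul_ne_zero (pow_ne_zero _ (by simpa using hβ)) (by simpa using hb0')
  have key : η ^ classNumber K * unitsConj σ v = η' ^ classNumber K * v := by
    refine Units.ext (mul_right_cancel₀ hne ?_)
    push_cast
    rw [coe_unitsConj]
    have e1 : (η : 𝓞 L) ^ classNumber K * ringOfIntegersConj σ β ^ classNumber K =
      β ^ classNumber K := by rw [← mul_pow, hη]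
    have e2 : (η' : 𝓞 L) ^ classNumber K * ringOfIntegersConj σ β' ^ classNumber K =
      β' ^ classNumber K := by rw [← mul_pow, hη']
    linear_combination (ringOfIntegersConj σ (v : 𝓞 L) * algebraMap (𝓞 K) (𝓞 L) b') * e1
      - (ringOfIntegersConj σ (v : 𝓞 L) * algebraMap (𝓞 K) (𝓞 L) b * v) * e2
      + (η' : 𝓞 L) ^ classNumber K * v * hc - ringOfIntegersConj σ (v : 𝓞 L) * hv
  have key2 : (η / η') ^ classNumber K = D v := by
    rw [hD, MonoidHom.div_apply, MonoidHom.id_apply, div_pow, div_eq_div_iff_mul_eq_mul, key,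
      mul_comm]
  rw [hm, pow_succ, pow_mul, div_pow, hsq hηN, hsq hηN', ← map_div, ← map_pow] at key2
  exact ⟨v / (η / η') ^ m, by rw [map_div, ← key2, mul_div_cancel_left]⟩

end Quadratic

section Quadratic

variable {K L : Type*} [Field K] [Field L] [Algebra K L] [NumberField K] [NumberField L]

/-- A unit of relative norm one gives rise, via Hilbert 90, to a principal ideal invariant under
conjugation, which is the product of an ideal of `K` and of a squarefree product of ramified
primes. -/
theorem exists_span_eq_map_mul_prod (h2 : Module.finrank K L = 2) {σ : L ≃ₐ[K] L} (hσ : σ ≠ 1)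
    (S : Finset (Ideal (𝓞 L)))
    (hS : ∀ P : Ideal (𝓞 L), P.IsMaximal → (∀ x, ringOfIntegersConj σ x - x ∈ P) → P ∈ S)
    {η : (𝓞 L)ˣ} (hη : η * unitsConj σ η = 1) :
    ∃ T ⊆ S, ∃ β : 𝓞 L, β ≠ 0 ∧ η * ringOfIntegersConj σ β = β ∧ ∃ B : Ideal (𝓞 K), B ≠ ⊥ ∧
      Ideal.span {β} = B.map (algebraMap (𝓞 K) (𝓞 L)) * ∏ P ∈ T, P := by
  obtain ⟨β, hβ, h⟩ := exists_mul_conj_eq h2 hσ (x := (η : 𝓞 L)) (y := 1) one_ne_zero (by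
    rw [map_one, one_mul]
    exact congrArg Units.val hη)
  rw [one_mul] at h
  have hinv : (Ideal.span {β}).map (ringOfIntegersConj σ) = Ideal.span {β} := by
    rw [Ideal.map_span, Set.image_singleton, Ideal.span_singleton_eq_span_singleton]
    exact ⟨η, by rw [mul_comm, h]⟩
  obtain ⟨T, hT, B, hB, hTB⟩ := exists_eq_map_mul_prod h2 hσ S hS _ (by simpa using hβ) hinv
  exact ⟨T, hT, β, hβ, h, B, hB, hTB⟩

/-- If the unit index count leaves no room for further ambiguous classes, all norm residue
conditions cutting out `T` are sufficient for a unit to be a norm and every product of ramified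
primes comes from a unit of relative norm one. -/
theorem exists_unit_of_index_le (h2 : Module.finrank K L = 2) {σ : L ≃ₐ[K] L} (hσ : σ ≠ 1)
    (hK : Odd (classNumber K)) (S : Finset (Ideal (𝓞 L)))
    (hS : ∀ P : Ideal (𝓞 L), P.IsMaximal → (∀ x, ringOfIntegersConj σ x - x ∈ P) → P ∈ S)
    (T : Subgroup (𝓞 K)ˣ)
    (hT : ∀ (u : (𝓞 K)ˣ) (a : (𝓞 L)ˣ), a * ringOfIntegersConj σ a =
      algebraMap (𝓞 K) (𝓞 L) u → u ∈ T)
    (hindex : 2 ^ (S.card + 2 * Units.rank K) ≤ T.index * 2 ^ Units.rank L) :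
    (∀ u ∈ T, ∃ a : (𝓞 L)ˣ, a * ringOfIntegersConj σ a = algebraMap (𝓞 K) (𝓞 L) u) ∧
    ∀ R ⊆ S, ∃ β : 𝓞 L, β ≠ 0 ∧ ∃ B : Ideal (𝓞 K), B ≠ ⊥ ∧
      Ideal.span {β} = B.map (algebraMap (𝓞 K) (𝓞 L)) * ∏ P ∈ R, P := by
  classical
  set N : (𝓞 L)ˣ →* (𝓞 L)ˣ := MonoidHom.id _ * unitsConj σ with hN
  set D : (𝓞 L)ˣ →* (𝓞 L)ˣ := MonoidHom.id _ / unitsConj σ with hD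
  set ι : (𝓞 K)ˣ →* (𝓞 L)ˣ := Units.map (algebraMap (𝓞 K) (𝓞 L) : 𝓞 K →* 𝓞 L) with hι
  have hNa : ∀ a, N a = a * unitsConj σ a := fun a => rfl
  have hDa : ∀ a, D a = a / unitsConj σ a := fun a => rfl
  have hss := unitsConj_unitsConj h2 hσ
  have hND : ∀ a, N (D a) = 1 := by
    intro a
    rw [hNa, hDa, map_div, hss, div_mul_div_cancel, div_self']
  have hDN : ∀ a, D (N a) = 1 := by
    intro a
    rw [hNa, hDa, map_mul, hss, mul_comm, div_self']
  have hsq : ∀ a, a ^ 2 = N a * D a := by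
    intro a
    rw [hNa, hDa, pow_two, mul_assoc, mul_div_cancel]
  have hDker : D.ker = ι.range := ker_id_div_unitsConj h2 hσ
  have hιinj : Function.Injective ι :=
    Units.map_injective (FaithfulSMul.algebraMap_injective (𝓞 K) (𝓞 L))
  have hneg : unitsConj σ (-1) = -1 := by
    ext
    rw [coe_unitsConj]
    simp
  have hformula := relIndex_range_ker_mul N D hND hDN hsq (e := -1)
    (by rw [hNa, hneg]; simp) (by rw [hDa, hneg]; simp)
    (fun h => by
      have := congrArg Units.val h
      rw [Units.val_neg, Units.val_one] at this
      norm_num at this) (fun a => by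
      rw [← Units.val_inj, ← Units.val_inj, ← Units.val_inj]
      push_cast
      exact sq_eq_one_iff)
  have hrank := finrank_ker_add_finrank_ker N D hDN hsq
  rw [Units.finrank_eq] at hrank
  have hDrank : Module.finrank ℤ (Additive D.ker) = Units.rank K := by
    rw [← Units.finrank_eq, hDker]
    exact (MulEquiv.toAdditive (MonoidHom.ofInjective hιinj)).toIntLinearEquiv.finrank_eq.symm
  rw [hDrank] at hrank hformula
  set NK := N.range.comap ι with hNK
  have hNKindex : NK.index = N.range.relIndex D.ker := by rw [hDker, hNK, Subgroup.index_comap]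
  rw [← hNKindex] at hformula
  have hNKT : NK ≤ T := by
    rintro u ⟨a, ha⟩
    exact hT u a (congrArg Units.val ha)
  choose! R hR β hβ hηβ B hB hspan using
    fun (η : (𝓞 L)ˣ) => exists_span_eq_map_mul_prod h2 hσ S hS (η := η)
  have hmem : ∀ η : N.ker, (η : (𝓞 L)ˣ) * unitsConj σ η = 1 := fun η => η.2
  let f : (N.ker ⧸ D.range.subgroupOf N.ker) → S.powerset :=
    fun q => ⟨R q.out, Finset.mem_powerset.2 (hR _ (hmem q.out))⟩
  have hf : Function.Injective f := by
    intro q q' h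
    have hRR : R q.out = R q'.out := congrArg Subtype.val h
    symm
    rw [← q.out_eq', ← q'.out_eq', QuotientGroup.eq]
    have hm := div_mem_range_of_mul_map_eq hK (hβ _ (hmem q.out)) (hηβ _ (hmem q.out))
      (hηβ _ (hmem q'.out))
      (hmem _) (hmem _) (hB _ (hmem q.out)) (hB _ (hmem q'.out)) (by
        rw [hspan _ (hmem q.out), hspan _ (hmem q'.out), hRR]
        ring)
    rw [Subgroup.mem_subgroupOf]
    rw [div_eq_inv_mul] at hm
    exact hm
  have hcardS : Nat.card S.powerset = 2 ^ S.card := by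
    rw [Nat.card_eq_fintype_card, Fintype.card_coe, Finset.card_powerset]
  have hfin : Finite (N.ker ⧸ D.range.subgroupOf N.ker) := Finite.of_injective f hf
  have hle := Nat.card_le_card_of_injective f hf
  have hpos : 0 < Nat.card (N.ker ⧸ D.range.subgroupOf N.ker) := Nat.card_pos
  have hidx : D.range.relIndex N.ker = Nat.card (N.ker ⧸ D.range.subgroupOf N.ker) := rfl
  rw [hcardS] at hle
  rw [hidx] at hformula
  set q := Nat.card (N.ker ⧸ D.range.subgroupOf N.ker) with hq
  set d := Module.finrank ℤ (Additive N.ker) with hd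
  have hmul := Subgroup.relIndex_mul_index hNKT
  have hA : 0 < 2 ^ d := by positivity
  have hB' : 0 < 2 ^ Units.rank K := by positivity
  have h1 : 0 < NK.index * 2 ^ d := by rw [hformula]; positivity
  have hNKpos : 0 < NK.index := pos_of_mul_pos_left h1 hA.le
  have hTpos : 0 < T.index := Nat.pos_of_ne_zero fun h => by rw [h, mul_zero] at hmul; omega
  have hrpos : 0 < NK.relIndex T := Nat.pos_of_ne_zero fun h => by rw [h, zero_mul] at hmul; omega
  have hindex' : 2 ^ S.card * 2 ^ Units.rank K ≤ T.index * 2 ^ d := by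
    rw [← hrank, pow_add, pow_add, two_mul, pow_add, ← mul_assoc, ← mul_assoc] at hindex
    exact Nat.le_of_mul_le_mul_right hindex hB'
  have hTle : T.index * 2 ^ d ≤ NK.index * 2 ^ d := by
    rw [← hmul]
    exact Nat.mul_le_mul_right _ (Nat.le_mul_of_pos_left _ hrpos)
  have hqle : q * 2 ^ Units.rank K ≤ 2 ^ S.card * 2 ^ Units.rank K := Nat.mul_le_mul_right _ hle
  have hqeq : q = 2 ^ S.card := Nat.eq_of_mul_eq_mul_right hB' (by omega)
  have hTeq : T.index = NK.index := Nat.eq_of_mul_eq_mul_right hA (by omega)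
  have hTNK : T ≤ NK := by
    rw [← Subgroup.relIndex_eq_one]
    exact Nat.eq_of_mul_eq_mul_right hTpos (by rw [hmul, one_mul, hTeq])
  constructor
  · intro u hu
    obtain ⟨a, ha⟩ := hTNK hu
    exact ⟨a, congrArg Units.val ha⟩
  · intro Q hQ
    have hbij := (Nat.bijective_iff_injective_and_card f).2 ⟨hf, by rw [hcardS, ← hqeq]⟩
    obtain ⟨η, hη⟩ := hbij.2 ⟨Q, Finset.mem_powerset.2 hQ⟩
    have hQ' : R η.out = Q := congrArg Subtype.val hη
    exact ⟨β η.out, hβ _ (hmem η.out), B η.out, hB _ (hmem η.out), hQ' ▸ hspan _ (hmem η.out)⟩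

theorem odd_classNumber_of_index_le (h2 : Module.finrank K L = 2) {σ : L ≃ₐ[K] L} (hσ : σ ≠ 1)
    (hK : Odd (classNumber K)) (S : Finset (Ideal (𝓞 L)))
    (hS : ∀ P : Ideal (𝓞 L), P.IsMaximal → (∀ x, ringOfIntegersConj σ x - x ∈ P) → P ∈ S)
    (T : Subgroup (𝓞 K)ˣ)
    (hT : ∀ (u : (𝓞 K)ˣ) (I : Ideal (𝓞 L)) (x y : 𝓞 L), I ≠ ⊥ → x ≠ 0 → y ≠ 0 →
      Ideal.span {x} * I = Ideal.span {y} * I.map (ringOfIntegersConj σ) →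
      x * ringOfIntegersConj σ x =
        algebraMap (𝓞 K) (𝓞 L) u * (y * ringOfIntegersConj σ y) → u ∈ T)
    (hindex : 2 ^ (S.card + 2 * Units.rank K) ≤ T.index * 2 ^ Units.rank L) :
    Odd (classNumber L) := by
  obtain ⟨hnorm, hprod⟩ := exists_unit_of_index_le h2 hσ hK S hS T (fun u a ha =>
    hT u ⊤ a 1 top_ne_bot a.ne_zero one_ne_zero (by
      rw [Ideal.span_singleton_eq_top.2 a.isUnit, Ideal.span_singleton_eq_top.2 isUnit_one,
        Ideal.map_top]) (by rw [ha, map_one, mul_one, mul_one])) hindex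
  rw [← Nat.not_even_iff_odd, even_iff_two_dvd]
  intro heven
  have : Fact (Nat.Prime 2) := ⟨Nat.prime_two⟩
  obtain ⟨C, hC⟩ := exists_prime_orderOf_dvd_card 2 heven
  obtain ⟨⟨I, hImem⟩, rfl⟩ := ClassGroup.mk0_surjective C
  have hI : I ≠ ⊥ := nonZeroDivisors.ne_zero hImem
  set h := classNumber K with hh
  set c := ringOfIntegersConj σ with hc
  have hcc := ringOfIntegersConj_conj h2 hσ
  obtain ⟨b, hb0, hb⟩ := exists_pow_classNumber_eq_span (K := K) (I := Ideal.relNorm (𝓞 K) I)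
    (by simpa using hI)
  set b' := algebraMap (𝓞 K) (𝓞 L) b with hb'
  have hb'0 : b' ≠ 0 := by simpa [hb'] using hb0
  have hcb : c b' = b' := ringOfIntegersConj_algebraMap σ b
  have hnormI : I ^ h * (I ^ h).map c = Ideal.span {b'} := by
    rw [Ideal.map_pow, ← mul_pow, ← map_relNorm_eq h2 hσ, ← Ideal.map_pow, hb, Ideal.map_span,
      Set.image_singleton]
  have hIsq : ∃ γ : 𝓞 L, I ^ h * I ^ h = Ideal.span {γ} := by
    have h1 : ClassGroup.mk0 ⟨I ^ h * I ^ h, mem_nonZeroDivisors_of_ne_zero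
        (mul_ne_zero (pow_ne_zero h hI) (pow_ne_zero h hI))⟩ = 1 := by
      have : (⟨I ^ h * I ^ h, mem_nonZeroDivisors_of_ne_zero
        (mul_ne_zero (pow_ne_zero h hI) (pow_ne_zero h hI))⟩ : nonZeroDivisors (Ideal (𝓞 L))) =
        (⟨I, hImem⟩ ^ 2) ^ h := Subtype.ext (by
          change I ^ h * I ^ h = (I ^ 2) ^ h
          rw [← mul_pow, pow_two])
      rw [this, map_pow, map_pow, ← hC, pow_orderOf_eq_one, one_pow]
    rw [ClassGroup.mk0_eq_one_iff] at h1
    exact h1.principal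
  obtain ⟨γ, hγ⟩ := hIsq
  have hIh : I ^ h ≠ ⊥ := pow_ne_zero h hI
  have hγ0 : γ ≠ 0 := by
    rintro rfl
    exact mul_ne_zero hIh hIh (by simpa using hγ)
  have hcγ0 : c γ ≠ 0 := by simpa using hγ0
  have hcγ : (I ^ h).map c * (I ^ h).map c = Ideal.span {c γ} := by
    rw [← Ideal.map_mul, hγ, Ideal.map_span, Set.image_singleton]
  have hbI : Ideal.span {b'} * I ^ h = Ideal.span {γ} * (I ^ h).map c := by
    rw [← hnormI, ← hγ]
    ring
  have hassoc : Associated (γ * c γ) (b' * c b') := by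
    rw [← Ideal.span_singleton_eq_span_singleton, ← Ideal.span_singleton_mul_span_singleton,
      ← Ideal.span_singleton_mul_span_singleton, hcb, ← hγ, ← hcγ, ← hnormI]
    ring
  obtain ⟨v, hv⟩ := hassoc
  have hcv : unitsConj σ v = v := by
    refine Units.ext (mul_left_cancel₀ (mul_ne_zero hγ0 hcγ0) ?_)
    rw [coe_unitsConj, hv]
    have := congrArg c hv
    rw [map_mul, map_mul, map_mul, hcc, hcc, mul_comm (c γ), mul_comm (c b')] at this
    exact this
  have hvrange : v ∈ (Units.map (algebraMap (𝓞 K) (𝓞 L) : 𝓞 K →* 𝓞 L)).range := by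
    rw [← ker_id_div_unitsConj h2 hσ, MonoidHom.mem_ker, MonoidHom.div_apply, MonoidHom.id_apply,
      hcv, div_self']
  obtain ⟨u, rfl⟩ := hvrange
  have huT : u ∈ T := hT u (I ^ h) b' γ hIh hb'0 hγ0 hbI (by rw [← hv, mul_comm]; rfl)
  obtain ⟨w, hw⟩ := hnorm u huT
  obtain ⟨β, hβ0, hβ⟩ := exists_mul_conj_eq h2 hσ (x := b') (y := w * γ)
    (mul_ne_zero w.ne_zero hγ0) (by
      rw [← hc, ← hv, map_mul]
      have hw' : w * c w = algebraMap (𝓞 K) (𝓞 L) u := hw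
      change γ * c γ * algebraMap (𝓞 K) (𝓞 L) u = _
      rw [← hw']
      ring)
  have hinv : (Ideal.span {β} * I ^ h).map c = Ideal.span {β} * I ^ h := by
    apply mul_left_cancel₀ (a := Ideal.span {b'}) (by simpa using hb'0)
    rw [mul_left_comm (Ideal.span {b'}), hbI, Ideal.map_mul, Ideal.map_span, Set.image_singleton,
      ← mul_assoc, ← mul_assoc, Ideal.span_singleton_mul_span_singleton, hβ,
      Ideal.span_singleton_mul_span_singleton, mul_comm β γ, mul_assoc (w : 𝓞 L),
      ← Ideal.span_singleton_mul_span_singleton (w : 𝓞 L),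
      Ideal.span_singleton_eq_top.2 w.isUnit, Ideal.top_mul]
  obtain ⟨R, hRS, B, hB, hRB⟩ := exists_eq_map_mul_prod h2 hσ S hS _
    (mul_ne_zero (by simpa using hβ0) hIh) hinv
  obtain ⟨δ, hδ, B', hB', hδB⟩ := hprod R hRS
  obtain ⟨e, he0, he⟩ := exists_pow_classNumber_eq_span hB
  obtain ⟨e', he0', he'⟩ := exists_pow_classNumber_eq_span hB'
  have hrel : Ideal.span {β} * I ^ h * B'.map (algebraMap (𝓞 K) (𝓞 L)) =
      Ideal.span {δ} * B.map (algebraMap (𝓞 K) (𝓞 L)) := by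
    rw [hRB, hδB]
    ring
  have hrel2 := congrArg (· ^ h) hrel
  simp only [mul_pow, ← Ideal.map_pow] at hrel2
  rw [he, he'] at hrel2
  simp only [Ideal.map_span, Set.image_singleton, Ideal.span_singleton_pow,
    Ideal.span_singleton_mul_span_singleton] at hrel2
  rw [mul_right_comm, Ideal.span_singleton_mul_span_singleton] at hrel2
  have hone : ClassGroup.mk0 (⟨I, hImem⟩ : nonZeroDivisors (Ideal (𝓞 L))) ^ (h * h) = 1 := by
    rw [← map_pow, ← map_one (ClassGroup.mk0 (R := 𝓞 L)), ClassGroup.mk0_eq_mk0_iff]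
    refine ⟨β ^ h * algebraMap (𝓞 K) (𝓞 L) e', δ ^ h * algebraMap (𝓞 K) (𝓞 L) e,
      mul_ne_zero (pow_ne_zero _ hβ0) (by simpa using he0'),
      mul_ne_zero (pow_ne_zero _ hδ) (by simpa using he0), ?_⟩
    rw [SubmonoidClass.coe_pow, OneMemClass.coe_one, mul_one, pow_mul, hrel2]
  have hdvd := orderOf_dvd_of_pow_eq_one hone
  rw [hC] at hdvd
  exact Nat.not_even_iff_odd.2 (hK.mul hK) (even_iff_two_dvd.2 hdvd)

/-- Ramified primes may be counted in the base field. -/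
theorem odd_classNumber_of_index_le_of_comap_mem (h2 : Module.finrank K L = 2) {σ : L ≃ₐ[K] L}
    (hσ : σ ≠ 1) (hK : Odd (classNumber K)) (S : Finset (Ideal (𝓞 K)))
    (hS : ∀ P : Ideal (𝓞 L), P.IsMaximal → (∀ x, ringOfIntegersConj σ x - x ∈ P) →
      P.comap (algebraMap (𝓞 K) (𝓞 L)) ∈ S)
    (T : Subgroup (𝓞 K)ˣ)
    (hT : ∀ (u : (𝓞 K)ˣ) (I : Ideal (𝓞 L)) (x y : 𝓞 L), I ≠ ⊥ → x ≠ 0 → y ≠ 0 →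
      Ideal.span {x} * I = Ideal.span {y} * I.map (ringOfIntegersConj σ) →
      x * ringOfIntegersConj σ x =
        algebraMap (𝓞 K) (𝓞 L) u * (y * ringOfIntegersConj σ y) → u ∈ T)
    (hindex : 2 ^ (S.card + 2 * Units.rank K) ≤ T.index * 2 ^ Units.rank L) :
    Odd (classNumber L) := by
  let R : Set (Ideal (𝓞 L)) := {P | P.IsMaximal ∧ ∀ x, ringOfIntegersConj σ x - x ∈ P}
  let f : R → S := fun P => ⟨_, hS P.1 P.2.1 P.2.2⟩
  have hf : Function.Injective f := fun P Q h => Subtype.ext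
    (eq_of_comap_eq_of_map_conj_eq h2 hσ P.2.1 Q.2.1 (congrArg Subtype.val h)
      (map_conj_eq_of_inertia P.2.1 P.2.2))
  have hfin : R.Finite := Set.finite_coe_iff.1 (Finite.of_injective f hf)
  have hcard : hfin.toFinset.card ≤ S.card := by
    have := Nat.card_le_card_of_injective f hf
    rwa [Nat.card_coe_set_eq, Set.ncard_eq_toFinset_card R hfin, Nat.card_eq_fintype_card,
      Fintype.card_coe] at this
  refine odd_classNumber_of_index_le h2 hσ hK hfin.toFinset
    (fun P hP h => hfin.mem_toFinset.2 ⟨hP, h⟩) T hT (le_trans ?_ hindex)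
  exact Nat.pow_le_pow_right two_pos (by omega)

end Quadratic

section Generator

variable {K L : Type*} [Field K] [Field L] [Algebra K L]

theorem algHom_ext_of_finrank_eq_two (h2 : Module.finrank K L = 2) {s : L}
    (hs : s ∉ Set.range (algebraMap K L)) {E : Type*} [Field E] [Algebra K E] {f g : L →ₐ[K] E}
    (h : f s = g s) : f = g := by
  have hsimple := Subalgebra.isSimpleOrder_of_finrank_prime K L (h2 ▸ Nat.prime_two)
  have htop : AlgHom.equalizer f g = ⊤ := by
    refine (hsimple.eq_bot_or_eq_top _).resolve_left fun hb => hs ?_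
    have : s ∈ AlgHom.equalizer f g := h
    rw [hb] at this
    exact Algebra.mem_bot.1 this
  ext x
  have : x ∈ AlgHom.equalizer f g := htop ▸ Algebra.mem_top
  exact this

theorem exists_algEquiv_ne_one_of_finrank_eq_two [CharZero K] (h2 : Module.finrank K L = 2) :
    ∃ σ : L ≃ₐ[K] L, σ ≠ 1 := by
  have : Algebra.IsQuadraticExtension K L := ⟨h2⟩
  have hc : Nat.card (L ≃ₐ[K] L) = 2 := by rw [IsGalois.card_aut_eq_finrank, h2]
  obtain ⟨y, hy, -⟩ := Nat.card_eq_two_iff' (1 : L ≃ₐ[K] L) |>.1 hc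
  exact ⟨y, hy⟩

theorem conj_eq_neg_of_finrank_eq_two (h2 : Module.finrank K L = 2) {σ : L ≃ₐ[K] L} (hσ : σ ≠ 1)
    {s : L} (hs : s ∉ Set.range (algebraMap K L)) {d : K} (hd : s ^ 2 = algebraMap K L d) :
    σ s = -s := by
  have h1 : (σ s) ^ 2 = s ^ 2 := by rw [← map_pow, hd, σ.commutes]
  refine (sq_eq_sq_iff_eq_or_eq_neg.1 h1).resolve_left fun h => hσ ?_
  have := algHom_ext_of_finrank_eq_two h2 hs (f := (σ : L →ₐ[K] L)) (g := AlgHom.id K L) h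
  ext x
  exact DFunLike.congr_fun this x

end Generator

theorem Complex.conj_eq_self_of_sq_eq_ofReal {z : ℂ} {r : ℝ} (hr : 0 ≤ r) (h : z ^ 2 = r) :
    (starRingEnd ℂ) z = z := by
  have h2 : z ^ 2 = ((Real.sqrt r : ℝ) : ℂ) ^ 2 := by
    rw [h, ← Complex.ofReal_pow, Real.sq_sqrt hr]
  rcases sq_eq_sq_iff_eq_or_eq_neg.1 h2 with h | h <;> rw [h] <;> simp

section RealQuadratic

variable {k : Type*} [Field k] [NumberField k]

theorem notMem_range_of_sq_eq_prime {p : ℕ} (hp : p.Prime) {s : k} (hs : s ^ 2 = p) :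
    s ∉ Set.range (algebraMap ℚ k) := by
  rintro ⟨q, rfl⟩
  have h : q ^ 2 = p := (algebraMap ℚ k).injective (by rw [map_pow, hs, map_natCast])
  refine (irrational_nrt_of_notint_nrt 2 p (x := |(q : ℝ)|) ?_ ?_ two_pos).ne_rat |q| (by simp)
  · rw [sq_abs]; exact_mod_cast h
  · rintro ⟨n, hn⟩
    have h3 : (n : ℝ) ^ 2 = p := by rw [← hn, sq_abs]; exact_mod_cast h
    have h4 : n ^ 2 = (p : ℤ) := by exact_mod_cast h3
    exact (Nat.prime_iff_prime_int.1 hp).irreducible.not_isSquare ⟨n, by rw [← h4, sq]⟩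

theorem isTotallyReal_of_sq_eq_natCast (h2 : Module.finrank ℚ k = 2) {n : ℕ} {s : k}
    (hs : s ^ 2 = n) (hs' : s ∉ Set.range (algebraMap ℚ k)) : IsTotallyReal k := by
  refine ⟨fun v => ?_⟩
  rw [InfinitePlace.isReal_iff, ComplexEmbedding.isReal_iff]
  have h := algHom_ext_of_finrank_eq_two h2 hs' (E := ℂ)
    (f := (ComplexEmbedding.conjugate v.embedding).toRatAlgHom)
    (g := v.embedding.toRatAlgHom) (by
      refine Complex.conj_eq_self_of_sq_eq_ofReal (r := n) (by positivity) ?_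
      change v.embedding s ^ 2 = _
      rw [← map_pow, hs]; simp)
  ext x
  exact DFunLike.congr_fun h x

theorem units_rank_eq_one_of_isTotallyReal [IsTotallyReal k] (h2 : Module.finrank ℚ k = 2) :
    Units.rank k = 1 := by
  have := IsTotallyReal.finrank k
  rw [Units.rank, InfinitePlace.card_eq_nrRealPlaces_add_nrComplexPlaces,
    IsTotallyReal.nrComplexPlaces_eq_zero, ← this, h2]

theorem isMaximal_span_natCast_ringOfIntegers_rat {p : ℕ} (hp : p.Prime) :
    (Ideal.span {(p : 𝓞 ℚ)}).IsMaximal := by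
  have h1 : Prime (p : 𝓞 ℚ) := by
    rw [← MulEquiv.prime_iff Rat.ringOfIntegersEquiv.toMulEquiv]
    simpa using Nat.prime_iff_prime_int.1 hp
  have h2 : (Ideal.span {(p : 𝓞 ℚ)}).IsPrime := (Ideal.span_singleton_prime h1.ne_zero).2 h1
  exact h2.isMaximal (by simpa using h1.ne_zero)

theorem comap_ringOfIntegers_rat_eq_span {p : ℕ} (hp : p.Prime) {P : Ideal (𝓞 k)}
    (hP : P.IsMaximal) (h : (p : 𝓞 k) ∈ P) :
    P.comap (algebraMap (𝓞 ℚ) (𝓞 k)) = Ideal.span {(p : 𝓞 ℚ)} := by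
  refine ((isMaximal_span_natCast_ringOfIntegers_rat hp).eq_of_le ?_ ?_).symm
  · have := Ideal.isMaximal_comap_of_isIntegral_of_isMaximal (R := 𝓞 ℚ) P
    exact this.ne_top
  · rwa [Ideal.span_singleton_le_iff_mem, Ideal.mem_comap, map_natCast]

/-- For a square root `s` of `1 + 4m`, the algebraic integer `(1 + s) / 2`. -/
theorem exists_ringOfIntegers_two_mul_eq_one_add {m : ℤ} {s : k} (hs : s ^ 2 = 1 + 4 * m) :
    ∃ ω : 𝓞 k, 2 * (ω : k) = 1 + s ∧ ω ^ 2 = ω + m := by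
  have h : ((1 + s) / 2) ^ 2 = (1 + s) / 2 + m := by
    field_simp
    linear_combination hs
  have h_int : IsIntegral ℤ ((1 + s) / 2) := by
    refine ⟨Polynomial.X ^ 2 - Polynomial.X - Polynomial.C m, by monicity!, ?_⟩
    rw [Polynomial.eval₂_sub, Polynomial.eval₂_sub, Polynomial.eval₂_pow, Polynomial.eval₂_X,
      Polynomial.eval₂_C, h]
    simp
  obtain ⟨w, hw⟩ : ∃ w : 𝓞 k, (w : k) = (1 + s) / 2 := ⟨⟨_, h_int⟩, rfl⟩
  refine ⟨w, by rw [hw]; ring, RingOfIntegers.coe_injective ?_⟩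
  rw [RingOfIntegers.coe_eq_algebraMap] at hw
  rw [map_pow, map_add, map_intCast, hw, h]

theorem odd_classNumber_of_sq_eq_prime (h2 : Module.finrank ℚ k = 2) {p : ℕ} (hp : p.Prime)
    {s : k} (hs : s ^ 2 = p) (hp4 : p % 4 = 1) : Odd (classNumber k) := by
  obtain ⟨σ, hσ⟩ := exists_algEquiv_ne_one_of_finrank_eq_two h2
  have hs' := notMem_range_of_sq_eq_prime hp hs
  have := isTotallyReal_of_sq_eq_natCast h2 hs hs'
  have hσs : σ s = -s := conj_eq_neg_of_finrank_eq_two h2 hσ hs' (d := p) (by simpa using hs)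
  obtain ⟨m, hm⟩ : ∃ m : ℤ, (p : ℤ) = 1 + 4 * m := ⟨p / 4, by omega⟩
  have hm' : (p : k) = 1 + 4 * (m : k) := by exact_mod_cast congrArg (Int.cast : ℤ → k) hm
  obtain ⟨ω, hω, hω2⟩ := exists_ringOfIntegers_two_mul_eq_one_add (hs.trans hm')
  refine odd_classNumber_of_index_le_of_comap_mem h2 hσ (by rw [Rat.classNumber_eq]; exact odd_one)
    {Ideal.span {(p : 𝓞 ℚ)}} (fun P hP hin => ?_) ⊤ (fun u I x y _ _ _ _ _ => trivial) ?_
  · rw [Finset.mem_singleton]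
    apply comap_ringOfIntegers_rat_eq_span hp hP
    have h := hin ω
    have h3 : (p : 𝓞 k) = (ringOfIntegersConj σ ω - ω) * (1 - 2 * ω) := by
      ext
      have h4 : 2 * σ (ω : k) = 1 - s := by
        have := congrArg σ hω
        rw [map_mul, map_add, hσs, map_one, map_ofNat] at this
        rw [this]; ring
      simp only [map_sub, map_mul, map_natCast, map_one, map_ofNat, coe_ringOfIntegersConj]
      linear_combination (-(1 : k)) * hs + (σ (ω : k) - ω) * hω + s / 2 * (h4 - hω)
    rw [h3]
    exact P.mul_mem_right _ h
  · rw [units_rank_eq_one_of_isTotallyReal h2]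
    simp [Units.rank]

end RealQuadratic

section Quadratic

variable {K L : Type*} [Field K] [Field L] [Algebra K L] [NumberField K] [NumberField L]

theorem eq_of_comap_eq_of_conj_notMem (h2 : Module.finrank K L = 2) {σ : L ≃ₐ[K] L} (hσ : σ ≠ 1)
    {P Q : Ideal (𝓞 L)} (hP : P.IsMaximal) (hQ : Q.IsMaximal)
    (hcomap : P.comap (algebraMap (𝓞 K) (𝓞 L)) = Q.comap (algebraMap (𝓞 K) (𝓞 L)))
    {a : 𝓞 L} (haP : a ∈ P) (haQ : ringOfIntegersConj σ a ∉ Q) : P = Q := by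
  have h3 : P * P.map (ringOfIntegersConj σ) ≤ Q := by
    rw [← map_relNorm_eq h2 hσ, Ideal.map_le_iff_le_comap, ← hcomap]
    exact Ideal.relNorm_le_comap _ _
  rcases hQ.isPrime.mul_le.1 h3 with h | h
  · exact hP.eq_of_le hQ.ne_top h
  · exact absurd (h (Ideal.mem_map_of_mem _ haP)) haQ

/-- If a real embedding of the base field takes a negative value at `d`, then `√d` generates an
extension in which norms are positive at this embedding. -/
theorem embedding_pos_of_mul_conj_eq (h2 : Module.finrank K L = 2) {σ : L ≃ₐ[K] L} (hσ : σ ≠ 1)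
    {θ : L} {d : K} (hθ : θ ^ 2 = algebraMap K L d) (ψ : K →+* ℝ) (hψ : ψ d < 0)
    {u : K} {x y : L} (hx : x ≠ 0) (hy : y ≠ 0)
    (h : x * σ x = algebraMap K L u * (y * σ y)) : 0 < ψ u := by
  let _ : Algebra K ℂ := (Complex.ofRealHom.comp ψ).toAlgebra
  have hθK : θ ∉ Set.range (algebraMap K L) := by
    rintro ⟨a, rfl⟩
    rw [← map_pow] at hθ
    rw [← (algebraMap K L).injective hθ, map_pow] at hψ
    nlinarith [sq_nonneg (ψ a)]
  have hσθ := conj_eq_neg_of_finrank_eq_two h2 hσ hθK hθ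
  have : Algebra.IsQuadraticExtension K L := ⟨h2⟩
  let χ : L →ₐ[K] ℂ := IsAlgClosed.lift
  have hre : ∀ a : K, algebraMap K ℂ a = (ψ a : ℂ) := fun a => rfl
  let χ' : L →ₐ[K] ℂ :=
    { (starRingEnd ℂ).comp (χ : L →+* ℂ) with
      commutes' := fun a => by
        change (starRingEnd ℂ) (χ (algebraMap K L a)) = _
        rw [χ.commutes, hre, Complex.conj_ofReal] }
  have hχ' : ∀ a, χ' a = (starRingEnd ℂ) (χ a) := fun _ => rfl
  have hχθ : χ θ ^ 2 = (ψ d : ℂ) := by rw [← map_pow, hθ, χ.commutes, hre]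
  have key : χ' = χ.comp (σ : L →ₐ[K] L) := by
    refine algHom_ext_of_finrank_eq_two h2 hθK ?_
    change (starRingEnd ℂ) (χ θ) = χ (σ θ)
    rw [hσθ, map_neg]
    have h1 : (Complex.I * χ θ) ^ 2 = ((-ψ d : ℝ) : ℂ) := by
      rw [mul_pow, hχθ, Complex.I_sq]; push_cast; ring
    have h2 := Complex.conj_eq_self_of_sq_eq_ofReal (by linarith) h1
    rw [map_mul, Complex.conj_I] at h2
    exact mul_left_cancel₀ Complex.I_ne_zero (by linear_combination -h2)
  have hns : ∀ a : L, χ (a * σ a) = (Complex.normSq (χ a) : ℂ) := fun a => by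
    rw [map_mul, ← Complex.mul_conj, ← hχ', key]; rfl
  have h3 := congrArg χ h
  rw [hns, map_mul, hns, χ.commutes, hre] at h3
  have h4 : Complex.normSq (χ x) = ψ u * Complex.normSq (χ y) := by exact_mod_cast h3
  have h5 : 0 < Complex.normSq (χ x) := Complex.normSq_pos.2 ((map_ne_zero χ).2 hx)
  have h6 : 0 < Complex.normSq (χ y) := Complex.normSq_pos.2 ((map_ne_zero χ).2 hy)
  rw [h4] at h5
  exact pos_of_mul_pos_left h5 h6.le

open scoped Classical in
theorem three_le_card_infinitePlace [IsTotallyReal K] (hK : Module.finrank ℚ K = 2)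
    (h2 : Module.finrank K L = 2) {θ : L} {d : K} (hθ : θ ^ 2 = algebraMap K L d)
    (hθK : θ ∉ Set.range (algebraMap K L)) (ψ : K →+* ℝ) (hψ : 0 < ψ d) :
    3 ≤ Fintype.card (InfinitePlace L) := by
  have : Algebra.IsQuadraticExtension K L := ⟨h2⟩
  have hcard : Fintype.card (InfinitePlace K) = 2 := by
    rw [InfinitePlace.card_eq_nrRealPlaces_add_nrComplexPlaces,
      IsTotallyReal.nrComplexPlaces_eq_zero, ← IsTotallyReal.finrank, hK]
  have h := InfinitePlace.card_eq_card_isUnramifiedIn (k := K) (K := L)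
  rw [h2] at h
  have h3 := Finset.card_add_card_compl
    (Finset.univ.filter fun w : InfinitePlace K => w.IsUnramifiedIn L)
  rw [hcard] at h3
  have h4 : 0 < (Finset.univ.filter fun w : InfinitePlace K => w.IsUnramifiedIn L).card := by
    refine Finset.card_pos.2 ⟨InfinitePlace.mk (Complex.ofRealHom.comp ψ), ?_⟩
    rw [Finset.mem_filter]
    refine ⟨Finset.mem_univ _, fun w hw => ?_⟩
    rw [InfinitePlace.isUnramified_iff]
    left
    rw [InfinitePlace.isReal_iff, ComplexEmbedding.isReal_iff]
    have hw2 : w.embedding.comp (algebraMap K L) = Complex.ofRealHom.comp ψ := by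
      have h5 : InfinitePlace.mk (w.embedding.comp (algebraMap K L)) =
          InfinitePlace.mk (Complex.ofRealHom.comp ψ) := by
        rw [← InfinitePlace.comap_mk, InfinitePlace.mk_embedding, hw]
      rcases InfinitePlace.mk_eq_iff.1 h5 with h5 | h5
      · exact h5
      · ext x
        have h6 : (starRingEnd ℂ) (w.embedding (algebraMap K L x)) = ψ x := RingHom.congr_fun h5 x
        have h7 := congrArg (starRingEnd ℂ) h6
        rw [Complex.conj_conj, Complex.conj_ofReal] at h7
        exact h7
    let _ : Algebra K ℂ := (Complex.ofRealHom.comp ψ).toAlgebra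
    have hre : ∀ a : K, algebraMap K ℂ a = (ψ a : ℂ) := fun a => rfl
    let f : L →ₐ[K] ℂ := { w.embedding with commutes' := fun a => RingHom.congr_fun hw2 a }
    let g : L →ₐ[K] ℂ :=
      { ComplexEmbedding.conjugate w.embedding with
        commutes' := fun a => by
          change (starRingEnd ℂ) (f (algebraMap K L a)) = _
          rw [f.commutes, hre, Complex.conj_ofReal] }
    have hgf : g = f := by
      refine algHom_ext_of_finrank_eq_two h2 hθK ?_
      refine Complex.conj_eq_self_of_sq_eq_ofReal hψ.le ?_
      change f θ ^ 2 = _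
      rw [← map_pow, hθ, f.commutes, hre]
    ext x
    exact DFunLike.congr_fun hgf x
  rw [h]
  omega

end Quadratic

theorem exists_even_of_sq_add_four_eq {p : ℕ} (hp16 : p % 16 = 9) {a b : ℤ}
    (h : a ^ 2 + 4 = p * b ^ 2) : ∃ A B : ℤ, a = 2 * (4 * A) ∧ b = 2 * B := by
  have hp : (p : ZMod 16) = 9 := by
    rw [← Nat.div_add_mod p 16, hp16]
    push_cast
    have : (16 : ZMod 16) = 0 := by decide
    rw [this]; ring
  have cast_eq : ∀ {x y : ℤ}, x = y → (x : ZMod 16) = y := fun h => congrArg _ h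
  have h1 := cast_eq h
  push_cast [hp] at h1
  have h2 : ∀ x y : ZMod 16, x ^ 2 + 4 = 9 * y ^ 2 → 8 * x = 0 ∧ 8 * y = 0 := by decide
  have dvd_of : ∀ {x : ℤ}, (8 : ZMod 16) * x = 0 → 2 ∣ x := fun {x} hx => by
    have : ((8 * x : ℤ) : ZMod 16) = 0 := by push_cast; exact hx
    have := (ZMod.intCast_zmod_eq_zero_iff_dvd _ 16).1 this
    omega
  obtain ⟨a, rfl⟩ := dvd_of (h2 _ _ h1).1
  obtain ⟨b, rfl⟩ := dvd_of (h2 _ _ h1).2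
  have h3 : a ^ 2 + 1 = p * b ^ 2 := by linarith
  have h4 := cast_eq h3
  push_cast [hp] at h4
  have h5 : ∀ x y : ZMod 16, x ^ 2 + 1 = 9 * y ^ 2 → 4 * x = 0 := by decide
  have h6 : ((4 * a : ℤ) : ZMod 16) = 0 := by push_cast; exact h5 _ _ h4
  have h7 := (ZMod.intCast_zmod_eq_zero_iff_dvd _ 16).1 h6
  obtain ⟨c, rfl⟩ : 4 ∣ a := by omega
  exact ⟨c, b, rfl, rfl⟩

section RealQuadratic

variable {k : Type*} [Field k] [NumberField k]

theorem exists_intCast_eq_of_conj_eq (h2 : Module.finrank ℚ k = 2) {σ : k ≃ₐ[ℚ] k} (hσ : σ ≠ 1)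
    {z : 𝓞 k} (hz : ringOfIntegersConj σ z = z) : ∃ n : ℤ, z = n := by
  obtain ⟨y, rfl⟩ := exists_algebraMap_eq_of_conj_eq h2 hσ hz
  refine ⟨Rat.ringOfIntegersEquiv y, ?_⟩
  rw [← map_intCast (algebraMap (𝓞 ℚ) (𝓞 k))]
  congr 1
  apply Rat.ringOfIntegersEquiv.injective
  simp

/-- A unit of norm `-1` of a quadratic field `ℚ(√p)` with `p ≡ 9 (mod 16)`. -/
theorem exists_eq_add_mul_sqrt_of_norm_eq_neg_one (h2 : Module.finrank ℚ k = 2) {p : ℕ}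
    (hp : p.Prime) (hp16 : p % 16 = 9) {s : 𝓞 k} (hs : s ^ 2 = p) {ε : 𝓞 k}
    (hnorm : Algebra.norm ℚ (ε : k) = -1) :
    ∃ A B : ℤ, ε = 4 * A + B * s ∧ (4 * A) ^ 2 + 1 = p * B ^ 2 := by
  obtain ⟨σ, hσ⟩ := exists_algEquiv_ne_one_of_finrank_eq_two h2
  have hsk : (s : k) ^ 2 = p := by exact_mod_cast congrArg (algebraMap (𝓞 k) k) hs
  have hs' := notMem_range_of_sq_eq_prime hp hsk
  have hσs : ringOfIntegersConj σ s = -s := by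
    apply RingOfIntegers.coe_injective
    rw [map_neg]
    exact conj_eq_neg_of_finrank_eq_two h2 hσ hs' (d := p) (by simpa using hsk)
  have hn : ε * ringOfIntegersConj σ ε = -1 := by
    apply RingOfIntegers.coe_injective
    have := algebraNorm_eq_mul_of_finrank_eq_two h2 hσ (ε : k)
    rw [hnorm, map_neg, map_one] at this
    rw [map_mul, map_neg, map_one]
    exact this.symm
  set τ := ringOfIntegersConj σ
  have hττ : ∀ x, τ (τ x) = x := ringOfIntegersConj_conj h2 hσ
  obtain ⟨a, ha⟩ := exists_intCast_eq_of_conj_eq h2 hσ (z := ε + τ ε)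
    (by change τ _ = _; rw [map_add, hττ, add_comm])
  obtain ⟨b, hb⟩ := exists_intCast_eq_of_conj_eq h2 hσ (z := (ε - τ ε) * s)
    (by change τ _ = _; rw [map_mul, map_sub, hττ, hσs]; ring)
  have hab : (p : ℤ) * (a ^ 2 + 4) = b ^ 2 := by
    have : (p : 𝓞 k) * (a ^ 2 + 4) = b ^ 2 := by
      rw [← ha, ← hb, ← hs]
      linear_combination 4 * s ^ 2 * hn
    exact_mod_cast this
  have hpZ := Nat.prime_iff_prime_int.1 hp
  obtain ⟨b, rfl⟩ := hpZ.dvd_of_dvd_pow (Dvd.intro _ hab)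
  have hab2 : a ^ 2 + 4 = p * b ^ 2 := mul_left_cancel₀ hpZ.ne_zero (by rw [hab]; ring)
  obtain ⟨A, B, rfl, rfl⟩ := exists_even_of_sq_add_four_eq hp16 hab2
  refine ⟨A, B, ?_, by linarith⟩
  have hs0 : s ≠ 0 := by
    rintro rfl
    have : (p : 𝓞 k) = 0 := by rw [← hs]; ring
    exact hp.ne_zero (by exact_mod_cast this)
  push_cast at ha hb
  have h3 : ε - τ ε = 2 * B * s := mul_right_cancel₀ hs0 (by rw [hb, ← hs]; ring)
  exact mul_left_cancel₀ (two_ne_zero (α := 𝓞 k)) (by linear_combination ha + h3)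

end RealQuadratic

section SqrtUnit

variable {k L : Type*} [Field k] [NumberField k] [Field L] [Algebra k L]

theorem exists_card_le_one_of_conj_notMem [NumberField L] (h2 : Module.finrank k L = 2)
    {σ : L ≃ₐ[k] L} (hσ : σ ≠ 1) (B : Ideal (𝓞 k)) {a : 𝓞 L}
    (ha : ∀ Q : Ideal (𝓞 L), Q.IsMaximal → Q.comap (algebraMap (𝓞 k) (𝓞 L)) = B → a ∈ Q →
      ringOfIntegersConj σ a ∉ Q) :
    ∃ S : Finset (Ideal (𝓞 L)), S.card ≤ 1 ∧ ∀ Q : Ideal (𝓞 L), Q.IsMaximal →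
      Q.comap (algebraMap (𝓞 k) (𝓞 L)) = B → a ∈ Q → Q ∈ S := by
  by_cases h : ∃ Q : Ideal (𝓞 L), Q.IsMaximal ∧ Q.comap (algebraMap (𝓞 k) (𝓞 L)) = B ∧ a ∈ Q
  · obtain ⟨Q, hQ, hBQ, haQ⟩ := h
    refine ⟨{Q}, by simp, fun Q' hQ' hBQ' haQ' => Finset.mem_singleton.2 ?_⟩
    exact eq_of_comap_eq_of_conj_notMem h2 hσ hQ' hQ (hBQ'.trans hBQ.symm) haQ' (ha Q hQ hBQ haQ)
  · exact ⟨∅, by simp, fun Q h1 h2 h3 => (h ⟨Q, h1, h2, h3⟩).elim⟩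

theorem notMem_range_of_sq_eq_of_norm_eq_neg_one {ε : k}
    (hnorm : Algebra.norm ℚ ε = -1) {θ : L} (hθ : θ ^ 2 = algebraMap k L ε) :
    θ ∉ Set.range (algebraMap k L) := by
  rintro ⟨a, rfl⟩
  rw [← map_pow] at hθ
  rw [← (algebraMap k L).injective hθ, map_pow] at hnorm
  nlinarith [sq_nonneg (Algebra.norm ℚ a)]

theorem odd_classNumber_of_sq_eq_unit [NumberField L] (h2 : Module.finrank ℚ k = 2)
    (hL : Module.finrank k L = 2) {p : ℕ} (hp : p.Prime) (hp16 : p % 16 = 9) {s : 𝓞 k}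
    (hs : s ^ 2 = p) {ε : (𝓞 k)ˣ} (hnorm : Algebra.norm ℚ ((ε : 𝓞 k) : k) = -1)
    (ψ : k →+* ℝ) (hψ : 0 < ψ ((ε : 𝓞 k) : k)) {θ : 𝓞 L}
    (hθ : θ ^ 2 = algebraMap (𝓞 k) (𝓞 L) ε) : Odd (classNumber L) := by
  have hsk : (s : k) ^ 2 = p := by exact_mod_cast congrArg (algebraMap (𝓞 k) k) hs
  have hsQ := notMem_range_of_sq_eq_prime hp hsk
  have := isTotallyReal_of_sq_eq_natCast h2 hsk hsQ
  have hθL : (θ : L) ^ 2 = algebraMap k L ((ε : 𝓞 k) : k) := congrArg (algebraMap (𝓞 L) L) hθ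
  have hθk := notMem_range_of_sq_eq_of_norm_eq_neg_one hnorm hθL
  obtain ⟨τ, hτ⟩ := exists_algEquiv_ne_one_of_finrank_eq_two h2
  obtain ⟨σ, hσ⟩ := exists_algEquiv_ne_one_of_finrank_eq_two hL
  have hσθ : ringOfIntegersConj σ θ = -θ := by
    apply RingOfIntegers.coe_injective
    rw [map_neg]
    exact conj_eq_neg_of_finrank_eq_two hL hσ hθk hθL
  have hτs : τ (s : k) = -s := conj_eq_neg_of_finrank_eq_two h2 hτ hsQ (d := p) (by simpa using hsk)
  obtain ⟨A, B, hε, hAB⟩ := exists_eq_add_mul_sqrt_of_norm_eq_neg_one h2 hp hp16 hs hnorm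
  have hBs : ((B : k) * s) ^ 2 = 1 + 4 * ((4 * A ^ 2 : ℤ) : k) := by
    have := congrArg (Int.cast : ℤ → k) hAB
    push_cast at this ⊢
    rw [mul_pow, hsk]
    linear_combination -this
  obtain ⟨ω, hω, hω2⟩ := exists_ringOfIntegers_two_mul_eq_one_add hBs
  rw [RingOfIntegers.coe_eq_algebraMap] at hω
  have hεω : (ε : 𝓞 k) = 2 * ω - 1 + 4 * A := by
    have : 2 * ω = 1 + B * s := by
      apply RingOfIntegers.coe_injective
      rw [map_mul, map_add, map_mul, map_one, map_ofNat, map_intCast]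
      exact hω
    rw [hε, this]; ring
  have hτω : ringOfIntegersConj τ ω = 1 - ω := by
    have h1 := congrArg τ hω
    rw [map_mul, map_add, map_ofNat, map_one, map_mul, map_intCast, hτs] at h1
    apply RingOfIntegers.coe_injective
    rw [map_sub, map_one]
    change τ ω = 1 - ω
    linear_combination (h1 + hω) / 2
  obtain ⟨S, hS1, hS⟩ := exists_card_le_one_of_conj_notMem h2 hτ
    (Ideal.span {((2 : ℕ) : 𝓞 ℚ)}) (a := ω) (fun Q hQ _ hωQ h =>
      hQ.ne_top (Q.eq_top_of_isUnit_mem (x := 1)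
      (by rw [hτω] at h; simpa using Q.add_mem h hωQ) isUnit_one))
  obtain ⟨z, hz⟩ : ∃ z : 𝓞 L, 2 * z = algebraMap (𝓞 k) (𝓞 L) ω * (1 + θ) := by
    have h_int : IsIntegral (𝓞 k) (algebraMap (𝓞 k) L ω * (1 + θ) / 2) := by
      refine ⟨Polynomial.X ^ 2 - Polynomial.C ω * Polynomial.X -
        Polynomial.C (2 * A ^ 2 * ω + A * ω ^ 2), by monicity!, ?_⟩
      rw [Polynomial.eval₂_sub, Polynomial.eval₂_sub, Polynomial.eval₂_pow, Polynomial.eval₂_mul,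
        Polynomial.eval₂_X, Polynomial.eval₂_C, Polynomial.eval₂_C]
      have h3 : (θ : L) ^ 2 = algebraMap (𝓞 k) L ε := hθL
      have h4 := congrArg (algebraMap (𝓞 k) L) hεω
      have h5 := congrArg (algebraMap (𝓞 k) L) hω2
      simp only [map_mul, map_add, map_sub, map_pow, map_one, map_ofNat, map_intCast] at h4 h5 ⊢
      push_cast at h5
      linear_combination algebraMap (𝓞 k) L ω ^ 2 / 4 * h3 + algebraMap (𝓞 k) L ω ^ 2 / 4 * h4 +
        algebraMap (𝓞 k) L ω / 2 * h5
    obtain ⟨z, hz⟩ : ∃ z : 𝓞 L, (z : L) = algebraMap (𝓞 k) L ω * (1 + θ) / 2 :=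
      ⟨⟨_, isIntegral_trans (R := ℤ) (A := 𝓞 k) _ h_int⟩, rfl⟩
    rw [RingOfIntegers.coe_eq_algebraMap] at hz
    refine ⟨z, RingOfIntegers.coe_injective ?_⟩
    rw [map_mul, map_mul, map_ofNat, hz, mul_div_cancel₀ _ two_ne_zero, map_add, map_one]
    rfl
  have hσz : ringOfIntegersConj σ z - z = -(algebraMap (𝓞 k) (𝓞 L) ω * θ) := by
    have h1 := congrArg (ringOfIntegersConj σ) hz
    rw [map_mul, map_mul, map_add, map_one, map_ofNat, hσθ, ringOfIntegersConj_algebraMap] at h1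
    exact mul_left_cancel₀ (two_ne_zero (α := 𝓞 L)) (by linear_combination h1 - hz)
  have hθunit : IsUnit θ := (isUnit_pow_iff two_ne_zero).1 (hθ ▸ ε.isUnit.map _)
  have hψ' : ψ (τ ((ε : 𝓞 k) : k)) < 0 := by
    have h1 := algebraNorm_eq_mul_of_finrank_eq_two h2 hτ ((ε : 𝓞 k) : k)
    have h3 := congrArg ψ h1
    rw [hnorm, map_neg, map_one, map_neg, map_one, map_mul] at h3
    nlinarith
  set ψ' : k →+* ℝ := ψ.comp (τ : k →+* k) with hψ'def
  refine odd_classNumber_of_index_le_of_comap_mem hL hσ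
    (odd_classNumber_of_sq_eq_prime h2 hp hsk (by omega)) S (fun P hP hin => ?_)
    ((Units.posSubgroup ℝ).comap (Units.map (ψ'.comp (algebraMap (𝓞 k) k)).toMonoidHom))
    (fun u I x y _ hx hy _ h => ?_) ?_
  · have hmem : ∀ x, x * θ ∈ P → x ∈ P := fun x hx =>
      (hP.isPrime.mem_or_mem hx).resolve_right fun h => hP.ne_top (P.eq_top_of_isUnit_mem h hθunit)
    refine hS _ (Ideal.isMaximal_comap_of_isIntegral_of_isMaximal P)
      (comap_ringOfIntegers_rat_eq_span Nat.prime_two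
        (Ideal.isMaximal_comap_of_isIntegral_of_isMaximal P) ?_) ?_
    · rw [Ideal.mem_comap, map_natCast]
      apply hmem
      have := P.neg_mem (hin θ)
      rw [hσθ] at this
      convert this using 1
      push_cast; ring
    · rw [Ideal.mem_comap]
      apply hmem
      have := P.neg_mem (hin z)
      rwa [hσz, neg_neg] at this
  · rw [Subgroup.mem_comap, Units.mem_posSubgroup]
    refine embedding_pos_of_mul_conj_eq hL hσ hθL ψ' hψ' (u := ((u : 𝓞 k) : k)) (x := x) (y := y)
      ?_ ?_ (congrArg (algebraMap (𝓞 L) L) h)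
    · exact RingOfIntegers.coe_ne_zero_iff.2 hx
    · exact RingOfIntegers.coe_ne_zero_iff.2 hy
  · have hidx : ((Units.posSubgroup ℝ).comap
        (Units.map (ψ'.comp (algebraMap (𝓞 k) k)).toMonoidHom)).index = 2 := by
      rw [Subgroup.index_eq_two_iff]
      refine ⟨-1, fun u => ?_⟩
      have h0 : ψ' ((u : 𝓞 k) : k) ≠ 0 :=
        (map_ne_zero ψ').2 (RingOfIntegers.coe_ne_zero_iff.2 u.ne_zero)
      have hval : ∀ v : (𝓞 k)ˣ, v ∈ (Units.posSubgroup ℝ).comap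
          (Units.map (ψ'.comp (algebraMap (𝓞 k) k)).toMonoidHom) ↔ 0 < ψ' ((v : 𝓞 k) : k) :=
        fun v => Iff.rfl
      have hneg : ψ' (((u * -1 : (𝓞 k)ˣ) : 𝓞 k) : k) = -ψ' ((u : 𝓞 k) : k) := by
        rw [mul_neg_one, Units.val_neg, RingOfIntegers.coe_eq_algebraMap,
          RingOfIntegers.coe_eq_algebraMap, map_neg, map_neg]
      rw [hval, hval, hneg]
      rcases h0.lt_or_gt with h | h
      · exact Or.inl ⟨by linarith, by linarith⟩
      · exact Or.inr ⟨h, by linarith⟩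
    have hrank : 2 ≤ Units.rank L := by
      have := three_le_card_infinitePlace h2 hL hθL hθk ψ hψ
      rw [Units.rank]
      classical
      convert Nat.sub_le_sub_right this 1
    rw [hidx, units_rank_eq_one_of_isTotallyReal h2]
    calc 2 ^ (S.card + 2 * 1) ≤ 2 ^ 3 := Nat.pow_le_pow_right two_pos (by omega)
      _ = 2 * 2 ^ 2 := by norm_num
      _ ≤ 2 * 2 ^ Units.rank L := Nat.mul_le_mul_left _ (Nat.pow_le_pow_right two_pos hrank)

end SqrtUnit

section Quadratic

variable {K L : Type*} [Field K] [Field L] [Algebra K L] [NumberField K] [NumberField L]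

/-- A prime with trivial inertia has ramification index one. -/
theorem exists_map_comap_eq_mul_of_not_inertia (h2 : Module.finrank K L = 2) {σ : L ≃ₐ[K] L}
    (hσ : σ ≠ 1) {P : Ideal (𝓞 L)} (hP : P.IsMaximal)
    (hin : ¬ ∀ x, ringOfIntegersConj σ x - x ∈ P) :
    ∃ J : Ideal (𝓞 L), ¬ J ≤ P ∧
      (P.comap (algebraMap (𝓞 K) (𝓞 L))).map (algebraMap (𝓞 K) (𝓞 L)) = P * J := by
  by_cases hinv : P.map (ringOfIntegersConj σ) = P
  · refine ⟨⊤, fun h => hP.ne_top (top_le_iff.1 h), ?_⟩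
    rw [Ideal.mul_top]
    exact (eq_map_comap_of_not_inertia h2 hσ hP hinv hin).symm
  · obtain ⟨J, hJ⟩ := Ideal.dvd_iff_le.2 (Ideal.map_comap_le (f := algebraMap (𝓞 K) (𝓞 L)) (K := P))
    refine ⟨J, fun hJP => hinv ?_, hJ⟩
    have hP0 : P ≠ ⊥ := by
      rintro rfl
      exact hinv Ideal.map_bot
    have h1 : P * P.map (ringOfIntegersConj σ) ≤ P * J := by
      rw [← hJ, ← map_relNorm_eq h2 hσ]
      exact Ideal.map_mono (Ideal.relNorm_le_comap _ _)
    have h3 : P.map (ringOfIntegersConj σ) ≤ P := by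
      rw [← Ideal.dvd_iff_le] at h1 hJP ⊢
      exact hJP.trans ((mul_dvd_mul_iff_left hP0).1 h1)
    have h4 : (P.map (ringOfIntegersConj σ)).IsMaximal :=
      Ideal.map_isMaximal_of_equiv (ringOfIntegersConj σ)
    exact h4.eq_of_le hP.ne_top h3

/-- If `x` and `y` have the same valuation at `P`, then `x / y` is a quotient of two elements
outside `P`. -/
theorem exists_mul_eq_mul_notMem {P : Ideal (𝓞 L)} (hP : Prime P) {x y : 𝓞 L} (hy : y ≠ 0)
    (h : emultiplicity P (Ideal.span {x}) = emultiplicity P (Ideal.span {y})) :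
    ∃ a b : 𝓞 L, a ∉ P ∧ b ∉ P ∧ x * b = y * a := by
  have hy0 : Ideal.span {y} ≠ ⊥ := by simpa using hy
  have hfin : FiniteMultiplicity P (Ideal.span {y}) := FiniteMultiplicity.of_prime_left hP hy0
  obtain ⟨Y, hY, hYP⟩ := hfin.exists_eq_pow_mul_and_not_dvd
  set m := multiplicity P (Ideal.span {y})
  have hx : P ^ m ∣ Ideal.span {x} := by
    apply pow_dvd_of_le_emultiplicity
    rw [h, hfin.emultiplicity_eq_multiplicity]
  obtain ⟨b, hbY, hbP⟩ := SetLike.not_le_iff_exists.1 (Ideal.dvd_iff_le.not.1 hYP)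
  have hmem : x * b ∈ Ideal.span {y} := by
    rw [hY]
    exact Ideal.mul_mem_mul (Ideal.dvd_iff_le.1 hx (Ideal.mem_span_singleton_self x)) hbY
  obtain ⟨a, ha⟩ := Ideal.mem_span_singleton'.1 hmem
  refine ⟨a, b, fun haP => ?_, hbP, by rw [← ha, mul_comm]⟩
  have h1 : emultiplicity P (Ideal.span {x} * Ideal.span {b}) =
      emultiplicity P (Ideal.span {a} * Ideal.span {y}) := by
    rw [Ideal.span_singleton_mul_span_singleton, Ideal.span_singleton_mul_span_singleton, ha]
  rw [emultiplicity_mul hP, emultiplicity_mul hP, h, hfin.emultiplicity_eq_multiplicity] at h1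
  have h3 : emultiplicity P (Ideal.span {b}) = 0 := by
    rw [emultiplicity_eq_zero, Ideal.dvd_span_singleton]; exact hbP
  rw [h3, add_zero] at h1
  have h4 : 1 ≤ emultiplicity P (Ideal.span {a}) := by
    apply le_emultiplicity_of_pow_dvd (k := 1)
    rw [pow_one, Ideal.dvd_span_singleton]; exact haP
  have h5 : (1 : ℕ∞) + m ≤ m := by
    calc (1 : ℕ∞) + m ≤ _ := add_le_add_left h4 _
      _ = m := h1.symm
  have : 1 + m ≤ m := by exact_mod_cast h5
  omega

/-- The unit comparing two conjugate ideals is a square modulo every ramified prime. -/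
theorem exists_sub_mem_of_mul_map_eq (h2 : Module.finrank K L = 2) {σ : L ≃ₐ[K] L} (hσ : σ ≠ 1)
    {P : Ideal (𝓞 L)} (hP : P.IsMaximal) (hin : ∀ x, ringOfIntegersConj σ x - x ∈ P)
    {u : 𝓞 K} {I : Ideal (𝓞 L)} {x y : 𝓞 L} (hI : I ≠ ⊥) (hy : y ≠ 0)
    (h : Ideal.span {x} * I = Ideal.span {y} * I.map (ringOfIntegersConj σ))
    (hxy : x * ringOfIntegersConj σ x =
      algebraMap (𝓞 K) (𝓞 L) u * (y * ringOfIntegersConj σ y)) :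
    ∃ a b : 𝓞 L, a ∉ P ∧ b ∉ P ∧ a ^ 2 - algebraMap (𝓞 K) (𝓞 L) u * b ^ 2 ∈ P := by
  have hP0 : P ≠ ⊥ := by
    rintro rfl
    obtain ⟨z, hz⟩ := exists_ringOfIntegersConj_ne hσ
    exact hz (sub_eq_zero.1 (by simpa using hin z))
  have hPp : Prime P := Ideal.prime_of_isPrime hP0 hP.isPrime
  have hinv := map_conj_eq_of_inertia hP hin
  have hmul : emultiplicity P (I.map (ringOfIntegersConj σ)) = emultiplicity P I := by
    have hle : ∀ (n : ℕ) (J : Ideal (𝓞 L)), P ^ n ∣ J → P ^ n ∣ J.map (ringOfIntegersConj σ) := by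
      intro n J hJ
      rw [Ideal.dvd_iff_le] at hJ ⊢
      calc J.map (ringOfIntegersConj σ) ≤ (P ^ n).map (ringOfIntegersConj σ) := Ideal.map_mono hJ
        _ = P ^ n := by rw [Ideal.map_pow, hinv]
    refine emultiplicity_eq_emultiplicity_iff.2 fun {n} => ⟨fun hn => ?_, hle n I⟩
    have := hle n _ hn
    rwa [map_conj_map_conj h2 hσ] at this
  have hfin : FiniteMultiplicity P I := FiniteMultiplicity.of_prime_left hPp hI
  have h1 := congrArg (emultiplicity P) h
  rw [emultiplicity_mul hPp, emultiplicity_mul hPp, hmul, hfin.emultiplicity_eq_multiplicity] at h1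
  have h3 : emultiplicity P (Ideal.span {x}) = emultiplicity P (Ideal.span {y}) := by
    exact (ENat.add_left_injective_of_ne_top (ENat.natCast_ne_top _)) h1
  obtain ⟨a, b, haP, hbP, hab⟩ := exists_mul_eq_mul_notMem hPp hy h3
  refine ⟨a, b, haP, hbP, ?_⟩
  have h4 : a * ringOfIntegersConj σ a =
      algebraMap (𝓞 K) (𝓞 L) u * (b * ringOfIntegersConj σ b) := by
    have hy' : y * ringOfIntegersConj σ y ≠ 0 := by simpa using hy
    apply mul_left_cancel₀ hy'
    have h5 := congrArg (ringOfIntegersConj σ) hab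
    rw [map_mul, map_mul] at h5
    linear_combination (b * ringOfIntegersConj σ b) * hxy - hab * ringOfIntegersConj σ x *
      ringOfIntegersConj σ b - y * a * h5
  have h6 : a ^ 2 - algebraMap (𝓞 K) (𝓞 L) u * b ^ 2 =
      algebraMap (𝓞 K) (𝓞 L) u * b * (ringOfIntegersConj σ b - b) -
        a * (ringOfIntegersConj σ a - a) := by
    linear_combination h4
  rw [h6]
  exact P.sub_mem (P.mul_mem_left _ (hin b)) (P.mul_mem_left _ (hin a))

end Quadratic

theorem intCast_mem_iff_of_natCast_mem {R : Type*} [CommRing R] {P : Ideal R} (hP : P ≠ ⊤) {p : ℕ}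
    (hp : p.Prime) (h : (p : R) ∈ P) (n : ℤ) : (n : R) ∈ P ↔ (p : ℤ) ∣ n := by
  refine ⟨fun hn => ?_, fun ⟨m, hm⟩ => ?_⟩
  · by_contra hd
    have hcop : IsCoprime (p : ℤ) n :=
      (Nat.prime_iff_prime_int.1 hp).irreducible.coprime_iff_not_dvd.2 hd
    obtain ⟨a, b, hab⟩ := hcop
    apply hP
    rw [Ideal.eq_top_iff_one]
    have h1 : (1 : R) = a * p + b * n := by exact_mod_cast congrArg (Int.cast : ℤ → R) hab.symm
    rw [h1]
    exact P.add_mem (P.mul_mem_left _ h) (P.mul_mem_left _ hn)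
  · rw [hm]
    push_cast
    exact P.mul_mem_right _ h

section RealQuadratic

variable {k : Type*} [Field k] [NumberField k]

theorem exists_two_mul_eq_add_mul_sqrt (h2 : Module.finrank ℚ k = 2) {p : ℕ} (hp : p.Prime)
    {s : 𝓞 k} (hs : s ^ 2 = p) (x : 𝓞 k) : ∃ m n : ℤ, 2 * x = m + n * s := by
  obtain ⟨σ, hσ⟩ := exists_algEquiv_ne_one_of_finrank_eq_two h2
  have hsk : (s : k) ^ 2 = p := by exact_mod_cast congrArg (algebraMap (𝓞 k) k) hs
  have hs' := notMem_range_of_sq_eq_prime hp hsk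
  have hσs : ringOfIntegersConj σ s = -s := by
    apply RingOfIntegers.coe_injective
    rw [map_neg]
    exact conj_eq_neg_of_finrank_eq_two h2 hσ hs' (d := p) (by simpa using hsk)
  set τ := ringOfIntegersConj σ
  have hττ : ∀ x, τ (τ x) = x := ringOfIntegersConj_conj h2 hσ
  obtain ⟨a, ha⟩ := exists_intCast_eq_of_conj_eq h2 hσ (z := x + τ x)
    (by change τ _ = _; rw [map_add, hττ, add_comm])
  obtain ⟨b, hb⟩ := exists_intCast_eq_of_conj_eq h2 hσ (z := (x - τ x) * s)
    (by change τ _ = _; rw [map_mul, map_sub, hττ, hσs]; ring)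
  obtain ⟨c, hc⟩ := exists_intCast_eq_of_conj_eq h2 hσ (z := (x - τ x) ^ 2)
    (by change τ _ = _; rw [map_pow, map_sub, hττ]; ring)
  have hbc : (p : ℤ) * c = b ^ 2 := by
    have : (p : 𝓞 k) * c = b ^ 2 := by rw [← hb, ← hc, ← hs]; ring
    exact_mod_cast this
  obtain ⟨b, rfl⟩ := (Nat.prime_iff_prime_int.1 hp).dvd_of_dvd_pow (Dvd.intro _ hbc)
  have hs0 : s ≠ 0 := by
    rintro rfl
    have : (p : 𝓞 k) = 0 := by rw [← hs]; ring
    exact hp.ne_zero (by exact_mod_cast this)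
  push_cast at hb
  have h3 : x - τ x = b * s := mul_right_cancel₀ hs0 (by rw [hb, ← hs]; ring)
  exact ⟨a, b, by linear_combination ha + h3⟩

theorem eq_span_sqrt_of_natCast_mem (h2 : Module.finrank ℚ k = 2) {p : ℕ} (hp : p.Prime)
    (hp2 : p ≠ 2) {s : 𝓞 k} (hs : s ^ 2 = p) {Q : Ideal (𝓞 k)} (hQ : Q.IsPrime)
    (hpQ : (p : 𝓞 k) ∈ Q) : Q = Ideal.span {s} := by
  have hsQ : s ∈ Q := hQ.mem_of_pow_mem 2 (hs ▸ hpQ)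
  refine le_antisymm (fun x hx => ?_) ((Ideal.span_singleton_le_iff_mem _).2 hsQ)
  obtain ⟨m, n, hmn⟩ := exists_two_mul_eq_add_mul_sqrt h2 hp hs x
  have hm : (m : 𝓞 k) ∈ Q := by
    have h1 : (m : 𝓞 k) = 2 * x - n * s := by rw [hmn]; ring
    rw [h1]
    exact Q.sub_mem (Q.mul_mem_left _ hx) (Q.mul_mem_left _ hsQ)
  obtain ⟨m, rfl⟩ := (intCast_mem_iff_of_natCast_mem hQ.ne_top hp hpQ m).1 hm
  obtain ⟨t, ht⟩ := hp.odd_of_ne_two hp2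
  have ht' : (p : 𝓞 k) = 2 * t + 1 := by exact_mod_cast congrArg (Nat.cast : ℕ → 𝓞 k) ht
  push_cast at hmn
  rw [Ideal.mem_span_singleton]
  exact ⟨s * x - t * (s * m + n), by
    linear_combination (-t : 𝓞 k) * hmn - x * ht' + (t * m - x) * hs⟩

end RealQuadratic

theorem exists_sq_modEq_of_sq_add_one_eq {p : ℕ} (hp : p.Prime) (hp8 : p % 8 = 1) {A N : ℤ}
    (h : A ^ 2 + 1 = p * N) : ∃ g : ℤ, (p : ℤ) ∣ g ^ 2 - A := by
  have := Fact.mk hp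
  have hA : (A : ZMod p) ^ 2 = -1 := by
    have := congrArg (Int.cast : ℤ → ZMod p) h
    push_cast at this
    rw [CharP.cast_eq_zero, zero_mul] at this
    linear_combination this
  have hA0 : (A : ZMod p) ≠ 0 := by
    intro h0
    rw [h0] at hA
    simp at hA
  obtain ⟨r, hr⟩ := (ZMod.euler_criterion p hA0).2 (by
    rw [show p / 2 = 2 * (2 * (p / 8)) by omega, pow_mul, pow_mul, hA]; simp)
  obtain ⟨g, rfl⟩ := ZMod.intCast_surjective r
  refine ⟨g, ?_⟩
  rw [← ZMod.intCast_zmod_eq_zero_iff_dvd]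
  push_cast
  rw [hr]; ring

theorem not_dvd_pow_eight_add_one {p : ℕ} (hp : p.Prime) (hp16 : p % 16 = 9) (n : ℤ) :
    ¬ (p : ℤ) ∣ n ^ 8 + 1 := by
  intro h
  have := Fact.mk hp
  have hn : (n : ZMod p) ^ 8 = -1 := by
    have := (ZMod.intCast_zmod_eq_zero_iff_dvd _ p).2 h
    push_cast at this
    linear_combination this
  have h2 : (-1 : ZMod p) ≠ 1 := by
    have : Fact (2 < p) := ⟨by have := hp.two_le; omega⟩
    exact ZMod.neg_one_ne_one
  have hn0 : (n : ZMod p) ≠ 0 := by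
    intro h0
    rw [h0] at hn
    simp at hn
  have hord : orderOf (n : ZMod p) = 2 ^ (3 + 1) :=
    orderOf_eq_prime_pow (by norm_num; rw [hn]; exact h2) (by
      rw [show 2 ^ (3 + 1) = 8 * 2 by norm_num, pow_mul, hn]; ring)
  have hd := orderOf_dvd_of_pow_eq_one (ZMod.pow_card_sub_one_eq_one hn0)
  rw [hord] at hd
  omega

section Tower

variable {k K M : Type*} [Field k] [NumberField k] [Field K] [NumberField K] [Field M]
  [NumberField M] [Algebra k K] [Algebra K M]

variable (hk : Module.finrank ℚ k = 2) (hK : Module.finrank k K = 2) (hM : Module.finrank K M = 2)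
  {p : ℕ} (hp : p.Prime) {s : 𝓞 k} (hs : s ^ 2 = p)

include hk hK hM hp hs in
theorem inertia_of_pow_four_eq (hp2 : p ≠ 2)
    {τ : K ≃ₐ[k] K} (hτ : τ ≠ 1) {σ : M ≃ₐ[K] M} (hσ : σ ≠ 1)
    {η : 𝓞 M} {v : (𝓞 M)ˣ} (hη : η ^ 4 = p * v) {P : Ideal (𝓞 M)} (hP : P.IsMaximal)
    (hpP : (p : 𝓞 M) ∈ P)
    (hin : ¬ ∀ x, ringOfIntegersConj τ x - x ∈ P.comap (algebraMap (𝓞 K) (𝓞 M))) :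
    ∀ x, ringOfIntegersConj σ x - x ∈ P := by
  by_contra hinM
  set Q := P.comap (algebraMap (𝓞 K) (𝓞 M)) with hQdef
  have hQ : Q.IsMaximal := Ideal.isMaximal_comap_of_isIntegral_of_isMaximal P
  have hpQ : (p : 𝓞 K) ∈ Q := by rw [hQdef, Ideal.mem_comap, map_natCast]; exact hpP
  have hq : Q.comap (algebraMap (𝓞 k) (𝓞 K)) = Ideal.span {s} :=
    eq_span_sqrt_of_natCast_mem hk hp hp2 hs (hQ.isPrime.comap _)
      (by rw [Ideal.mem_comap, map_natCast]; exact hpQ)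
  obtain ⟨J, hJ, hQJ⟩ := exists_map_comap_eq_mul_of_not_inertia hK hτ hQ hin
  obtain ⟨J', hJ', hPJ⟩ := exists_map_comap_eq_mul_of_not_inertia hM hσ hP hinM
  rw [hq, Ideal.map_span, Set.image_singleton] at hQJ
  have h1 := congrArg (Ideal.map (algebraMap (𝓞 K) (𝓞 M))) hQJ
  rw [← hQdef] at hPJ
  rw [Ideal.map_mul, hPJ, Ideal.map_span, Set.image_singleton] at h1
  set S : 𝓞 M := algebraMap (𝓞 K) (𝓞 M) (algebraMap (𝓞 k) (𝓞 K) s)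
  have hS : S ^ 2 = p := by rw [← map_pow, ← map_pow, hs, map_natCast, map_natCast]
  have hp0 : (p : 𝓞 M) ≠ 0 := Nat.cast_ne_zero.2 hp.ne_zero
  have hP0 : P ≠ ⊥ := by
    rintro rfl
    exact hp0 (by simpa using hpP)
  have hPp : Prime P := Ideal.prime_of_isPrime hP0 hP.isPrime
  have hη2 : Ideal.span {η} ^ 4 = Ideal.span {S} ^ 2 := by
    rw [Ideal.span_singleton_pow, Ideal.span_singleton_pow, hη, hS]
    exact Ideal.span_singleton_mul_right_unit v.isUnit _
  have hS1 : emultiplicity P (Ideal.span {S}) = 1 := by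
    rw [h1, emultiplicity_mul hPp, emultiplicity_mul hPp,
      (FiniteMultiplicity.of_prime_left hPp hP0).emultiplicity_self,
      emultiplicity_eq_zero.2 (Ideal.dvd_iff_le.not.2 hJ'),
      emultiplicity_eq_zero.2 (Ideal.dvd_iff_le.not.2 fun h => hJ (Ideal.map_le_iff_le_comap.1 h))]
    rfl
  have hη0 : Ideal.span {η} ≠ ⊥ := by
    intro h0
    have h3 : (p : 𝓞 M) * v = 0 := by
      rw [← hη, Ideal.span_singleton_eq_bot.1 h0]; ring
    exact hp0 ((mul_eq_zero_iff_right v.ne_zero).1 h3)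
  have h3 := congrArg (emultiplicity P) hη2
  rw [emultiplicity_pow hPp, emultiplicity_pow hPp, hS1,
    (FiniteMultiplicity.of_prime_left hPp hη0).emultiplicity_eq_multiplicity] at h3
  have h4 : 4 * multiplicity P (Ideal.span {η}) = 2 * 1 := by exact_mod_cast h3
  omega

include hk hK hM hp hs in
theorem exists_intCast_sub_mem_of_inertia (hp2 : p ≠ 2)
    {σ : M ≃ₐ[K] M} (hσ : σ ≠ 1) {τ : K ≃ₐ[k] K} (hτ : τ ≠ 1) {θ : 𝓞 K}
    (hτθ : ringOfIntegersConj τ θ = -θ) {P : Ideal (𝓞 M)} (hP : P.IsMaximal)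
    (hpP : (p : 𝓞 M) ∈ P) (hin : ∀ x, ringOfIntegersConj σ x - x ∈ P) {g : ℤ}
    (hg : ¬ (p : ℤ) ∣ g) (hgP : algebraMap (𝓞 K) (𝓞 M) θ - g ∈ P) (x : 𝓞 M) :
    ∃ n : ℤ, x - n ∈ P := by
  set a := algebraMap (𝓞 K) (𝓞 M)
  set b := algebraMap (𝓞 k) (𝓞 K)
  have hS : a (b s) ∈ P := by
    refine hP.isPrime.mem_of_pow_mem 2 ?_
    rw [← map_pow, ← map_pow, hs, map_natCast, map_natCast]; exact hpP
  obtain ⟨y, hy⟩ := exists_algebraMap_eq_of_conj_eq hM hσ (x := x + ringOfIntegersConj σ x)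
    (by rw [map_add, ringOfIntegersConj_conj hM hσ, add_comm])
  obtain ⟨z, hz⟩ := exists_algebraMap_eq_of_conj_eq hK hτ (x := y + ringOfIntegersConj τ y)
    (by rw [map_add, ringOfIntegersConj_conj hK hτ, add_comm])
  obtain ⟨w, hw⟩ := exists_algebraMap_eq_of_conj_eq hK hτ (x := (y - ringOfIntegersConj τ y) * θ)
    (by rw [map_mul, map_sub, ringOfIntegersConj_conj hK hτ, hτθ]; ring)
  obtain ⟨m, n, hmn⟩ := exists_two_mul_eq_add_mul_sqrt hk hp hs z
  obtain ⟨m', n', hmn'⟩ := exists_two_mul_eq_add_mul_sqrt hk hp hs w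
  have hcop : IsCoprime (p : ℤ) (8 * g) := by
    have hpZ := Nat.prime_iff_prime_int.1 hp
    refine hpZ.irreducible.coprime_iff_not_dvd.2 fun h => ?_
    rcases hpZ.dvd_or_dvd h with h | h
    · have h8 : (p : ℤ) ∣ 2 := hpZ.dvd_of_dvd_pow (n := 3) (by norm_num; exact h)
      exact hp2 ((Nat.prime_dvd_prime_iff_eq hp Nat.prime_two).1 (by exact_mod_cast h8))
    · exact hg h
  obtain ⟨c, d, hcd⟩ := hcop
  refine ⟨d * (m * g + m'), ?_⟩
  have e1 : a (b z) = a y + a (ringOfIntegersConj τ y) := by rw [hz, map_add]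
  have e2 : a (b w) = (a y - a (ringOfIntegersConj τ y)) * a θ := by rw [hw, map_mul, map_sub]
  have e3 : 2 * a (b z) = m + n * a (b s) := by
    have := congrArg (fun t => a (b t)) hmn
    simpa only [map_mul, map_add, map_ofNat, map_intCast] using this
  have e4 : 2 * a (b w) = m' + n' * a (b s) := by
    have := congrArg (fun t => a (b t)) hmn'
    simpa only [map_mul, map_add, map_ofNat, map_intCast] using this
  have e5 : (c : 𝓞 M) * p + d * (8 * g) = 1 := by
    exact_mod_cast congrArg (Int.cast : ℤ → 𝓞 M) hcd
  change a y = _ at hy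
  have key : x - ((d * (m * g + m') : ℤ) : 𝓞 M) =
      c * x * p - d * (8 * x) * (a θ - g) - d * (4 * a θ) * (ringOfIntegersConj σ x - x)
        + d * m * (a θ - g) + d * (n * a θ + n') * a (b s) := by
    push_cast
    linear_combination (-x) * e5 - d * 4 * a θ * hy + d * a θ * e3 + d * e4 - 2 * d * a θ * e1 -
      2 * d * e2
  rw [key]
  refine P.add_mem (P.add_mem (P.sub_mem (P.sub_mem ?_ ?_) ?_) ?_) ?_
  · exact P.mul_mem_left _ hpP
  · exact P.mul_mem_left _ hgP
  · exact P.mul_mem_left _ (hin x)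
  · exact P.mul_mem_left _ hgP
  · exact P.mul_mem_left _ hS

end Tower

section Octic

variable {k K M : Type*} [Field k] [NumberField k] [Field K] [NumberField K] [Field M]
  [NumberField M] [Algebra k K] [Algebra K M]

theorem odd_classNumber_of_pow_four_eq (hk : Module.finrank ℚ k = 2) (hK : Module.finrank k K = 2)
    (hM : Module.finrank K M = 2) {p : ℕ} (hp : p.Prime) (hp16 : p % 16 = 9) {s : 𝓞 k}
    (hs : s ^ 2 = p) {ε : (𝓞 k)ˣ} (hnorm : Algebra.norm ℚ ((ε : 𝓞 k) : k) = -1)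
    (ψ : k →+* ℝ) (hψ : 0 < ψ ((ε : 𝓞 k) : k)) {θ : 𝓞 K}
    (hθ : θ ^ 2 = algebraMap (𝓞 k) (𝓞 K) ε) [IsUnramifiedAtInfinitePlaces K M]
    {σ : M ≃ₐ[K] M} (hσ : σ ≠ 1)
    (hram : ∀ P : Ideal (𝓞 M), P.IsMaximal → (∀ x, ringOfIntegersConj σ x - x ∈ P) →
      (p : 𝓞 M) ∈ P)
    {η : 𝓞 M} {v : (𝓞 M)ˣ} (hη : η ^ 4 = p * v) : Odd (classNumber M) := by
  have hKodd := odd_classNumber_of_sq_eq_unit hk hK hp hp16 hs hnorm ψ hψ hθ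
  have hp2 : p ≠ 2 := by rintro rfl; omega
  have hpZ := Nat.prime_iff_prime_int.1 hp
  obtain ⟨τ, hτ⟩ := exists_algEquiv_ne_one_of_finrank_eq_two hK
  have hθK : (θ : K) ^ 2 = algebraMap k K ((ε : 𝓞 k) : k) := congrArg (algebraMap (𝓞 K) K) hθ
  have hτθ : ringOfIntegersConj τ θ = -θ := by
    apply RingOfIntegers.coe_injective
    rw [map_neg]
    exact conj_eq_neg_of_finrank_eq_two hK hτ
      (notMem_range_of_sq_eq_of_norm_eq_neg_one hnorm hθK) hθK
  have hθu : IsUnit θ := by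
    refine (isUnit_pow_iff two_ne_zero).1 ?_
    rw [hθ]; exact ε.isUnit.map _
  obtain ⟨A, B, hε, hAB⟩ := exists_eq_add_mul_sqrt_of_norm_eq_neg_one hk hp hp16 hs hnorm
  obtain ⟨g, hgA⟩ := exists_sq_modEq_of_sq_add_one_eq hp (by omega) hAB
  have hdvd : ∀ f : ℤ, (p : ℤ) ∣ f ^ 2 - 4 * A → ¬ (p : ℤ) ∣ f := by
    intro f hf hpf
    refine hpZ.not_dvd_one ?_
    have h1 : (p : ℤ) ∣ 4 * A := by
      have := dvd_sub (dvd_pow hpf two_ne_zero) hf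
      rwa [sub_sub_cancel] at this
    have h2 := dvd_sub (Dvd.intro _ hAB.symm) (dvd_pow h1 two_ne_zero)
    rwa [add_sub_cancel_left] at h2
  have hg := hdvd g hgA
  have hmem : ∀ Q : Ideal (𝓞 K), Q.IsMaximal → (p : 𝓞 K) ∈ Q →
      Q.comap (algebraMap (𝓞 k) (𝓞 K)) = Ideal.span {s} ∧ (θ - g) * (θ + g) ∈ Q := by
    intro Q hQ hpQ
    have hQs := eq_span_sqrt_of_natCast_mem hk hp hp2 hs
      (hQ.isPrime.comap (algebraMap (𝓞 k) (𝓞 K)))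
      (by rw [Ideal.mem_comap, map_natCast]; exact hpQ)
    refine ⟨hQs, ?_⟩
    have hsQ : algebraMap (𝓞 k) (𝓞 K) s ∈ Q := by
      rw [← Ideal.mem_comap, hQs]; exact Ideal.mem_span_singleton_self s
    have hgQ : ((g ^ 2 - 4 * A : ℤ) : 𝓞 K) ∈ Q :=
      (intCast_mem_iff_of_natCast_mem hQ.ne_top hp hpQ _).2 hgA
    have : (θ - g) * (θ + g) =
        B * algebraMap (𝓞 k) (𝓞 K) s - ((g ^ 2 - 4 * A : ℤ) : 𝓞 K) := by
      have h1 : θ ^ 2 = 4 * A + B * algebraMap (𝓞 k) (𝓞 K) s := by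
        rw [hθ, hε]; simp only [map_add, map_mul, map_ofNat, map_intCast]
      push_cast
      linear_combination h1
    rw [this]
    exact Q.sub_mem (Q.mul_mem_left _ hsQ) hgQ
  have h2Q : ∀ f : ℤ, (p : ℤ) ∣ f ^ 2 - 4 * A → ∀ Q : Ideal (𝓞 K), Q.IsMaximal →
      Q.comap (algebraMap (𝓞 k) (𝓞 K)) = Ideal.span {s} → θ - f ∈ Q →
      ringOfIntegersConj τ (θ - f) ∉ Q := by
    intro f hf Q hQ hQs hfQ hfQ'
    have hpQ : (p : 𝓞 K) ∈ Q := by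
      rw [← map_natCast (algebraMap (𝓞 k) (𝓞 K)), ← Ideal.mem_comap, hQs, ← hs]
      exact Ideal.pow_mem_of_mem _ (Ideal.mem_span_singleton_self s) 2 two_pos
    have h3 : ((2 * f : ℤ) : 𝓞 K) ∈ Q := by
      rw [map_sub, hτθ, map_intCast] at hfQ'
      have := Q.neg_mem (Q.add_mem hfQ hfQ')
      convert this using 1
      push_cast; ring
    rcases hpZ.dvd_or_dvd ((intCast_mem_iff_of_natCast_mem hQ.ne_top hp hpQ _).1 h3) with h | h
    · exact hp2 ((Nat.prime_dvd_prime_iff_eq hp Nat.prime_two).1 (by exact_mod_cast h))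
    · exact hdvd f hf h
  have hgA' : (p : ℤ) ∣ (-g) ^ 2 - 4 * A := by rwa [neg_sq]
  obtain ⟨S₁, hS₁, hS₁'⟩ := exists_card_le_one_of_conj_notMem hK hτ _ (h2Q g hgA)
  obtain ⟨S₂, hS₂, hS₂'⟩ := exists_card_le_one_of_conj_notMem hK hτ _ (h2Q (-g) hgA')
  obtain ⟨P, hP, hpP⟩ : ∃ P : Ideal (𝓞 M), P.IsMaximal ∧ (p : 𝓞 M) ∈ P := by
    have : Ideal.span {(p : 𝓞 M)} ≠ ⊤ := by
      rw [Ne, Ideal.span_singleton_eq_top]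
      intro hu
      have h1 : IsUnit (Algebra.norm ℤ (p : 𝓞 M)) := hu.map _
      rw [← map_natCast (algebraMap ℤ (𝓞 M)), Algebra.norm_algebraMap] at h1
      exact hpZ.not_isUnit ((isUnit_pow_iff Module.finrank_pos.ne').1 h1)
    obtain ⟨P, hP, hle⟩ := Ideal.exists_le_maximal _ this
    exact ⟨P, hP, hle (Ideal.mem_span_singleton_self _)⟩
  have hQ : (P.comap (algebraMap (𝓞 K) (𝓞 M))).IsMaximal :=
    Ideal.isMaximal_comap_of_isIntegral_of_isMaximal P
  have hpQ : (p : 𝓞 K) ∈ P.comap (algebraMap (𝓞 K) (𝓞 M)) := by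
    rw [Ideal.mem_comap, map_natCast]; exact hpP
  have hinK : ¬ ∀ x, ringOfIntegersConj τ x - x ∈ P.comap (algebraMap (𝓞 K) (𝓞 M)) := by
    intro h
    have h1 := h θ
    rw [hτθ, show -θ - θ = θ * ((-2 : ℤ) : 𝓞 K) by push_cast; ring] at h1
    rcases hQ.isPrime.mem_or_mem h1 with h2 | h2
    · exact hQ.ne_top (Ideal.eq_top_of_isUnit_mem _ h2 hθu)
    · have := (intCast_mem_iff_of_natCast_mem hQ.ne_top hp hpQ _).1 h2
      rw [dvd_neg] at this
      exact hp2 ((Nat.prime_dvd_prime_iff_eq hp Nat.prime_two).1 (by exact_mod_cast this))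
  have hin := inertia_of_pow_four_eq hk hK hM hp hs hp2 hτ hσ hη hP hpP hinK
  obtain ⟨f, hf, hfP⟩ : ∃ f : ℤ, (p : ℤ) ∣ f ^ 2 - 4 * A ∧
      algebraMap (𝓞 K) (𝓞 M) θ - f ∈ P := by
    rcases hQ.isPrime.mem_or_mem (hmem _ hQ hpQ).2 with h | h
    · refine ⟨g, hgA, ?_⟩
      rwa [Ideal.mem_comap, map_sub, map_intCast] at h
    · refine ⟨-g, hgA', ?_⟩
      rw [Ideal.mem_comap, map_add, map_intCast] at h
      rwa [Int.cast_neg, sub_neg_eq_add]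
  have hP0 : P ≠ ⊥ := by
    rintro rfl
    exact (Nat.cast_ne_zero (R := 𝓞 M)).2 hp.ne_zero (by simpa using hpP)
  let _ : Field (𝓞 M ⧸ P) := Ideal.Quotient.field P
  have _ : Finite (𝓞 M ⧸ P) := Ideal.finiteQuotientOfFreeOfNeBot P hP0
  let r : 𝓞 K →+* 𝓞 M ⧸ P := (Ideal.Quotient.mk P).comp (algebraMap (𝓞 K) (𝓞 M))
  let T : Subgroup (𝓞 K)ˣ :=
    ((powMonoidHom 2 : (𝓞 M ⧸ P)ˣ →* (𝓞 M ⧸ P)ˣ).range).comap (Units.map r)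
  have hT0 : T.index ≠ 0 := by
    rw [Subgroup.index_comap]
    have : Finite (𝓞 M ⧸ P)ˣ := inferInstance
    exact (inferInstance : ((powMonoidHom 2 : (𝓞 M ⧸ P)ˣ →*
      (𝓞 M ⧸ P)ˣ).range.subgroupOf _).FiniteIndex).index_ne_zero
  have hT1 : T.index ≠ 1 := by
    rw [Ne, Subgroup.index_eq_one]
    intro hT
    have h1 : hθu.unit ∈ T := hT ▸ Subgroup.mem_top _
    obtain ⟨w, hw⟩ := h1
    have hw1 : (w : 𝓞 M ⧸ P) ^ 2 = r θ := congrArg Units.val hw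
    obtain ⟨x, hx⟩ := Ideal.Quotient.mk_surjective (w : 𝓞 M ⧸ P)
    obtain ⟨n, hn⟩ := exists_intCast_sub_mem_of_inertia hk hK hM hp hs hp2 hσ hτ hτθ hP hpP hin
      (hdvd f hf) hfP x
    have hxθ : x ^ 2 - algebraMap (𝓞 K) (𝓞 M) θ ∈ P := by
      rw [← Ideal.Quotient.eq, map_pow, hx, hw1]; rfl
    have h2 : ((n ^ 2 - f : ℤ) : 𝓞 M) ∈ P := by
      have := P.add_mem (P.sub_mem hxθ (P.mul_mem_left (x + n) hn)) hfP
      convert this using 1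
      push_cast; ring
    have h3 := (intCast_mem_iff_of_natCast_mem hP.ne_top hp hpP _).1 h2
    refine not_dvd_pow_eight_add_one hp hp16 n ?_
    have h4 : n ^ 8 + 1 = (n ^ 2 - f) * ((n ^ 2 + f) * (n ^ 4 + f ^ 2)) +
        (f ^ 2 - 4 * A) * (f ^ 2 + 4 * A) + p * B ^ 2 := by rw [← hAB]; ring
    rw [h4]
    exact dvd_add (dvd_add (h3.mul_right _) (hf.mul_right _)) (dvd_mul_right _ _)
  classical
  refine odd_classNumber_of_index_le_of_comap_mem hM hσ hKodd (S₁ ∪ S₂) ?_ T ?_ ?_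
  · intro P' hP' hin'
    have hQ' : (P'.comap (algebraMap (𝓞 K) (𝓞 M))).IsMaximal :=
      Ideal.isMaximal_comap_of_isIntegral_of_isMaximal P'
    obtain ⟨h1, h2⟩ := hmem _ hQ' (by
      rw [Ideal.mem_comap, map_natCast]; exact hram P' hP' hin')
    rw [Finset.mem_union]
    rcases hQ'.isPrime.mem_or_mem h2 with h | h
    · exact Or.inl (hS₁' _ hQ' h1 h)
    · refine Or.inr (hS₂' _ hQ' h1 ?_)
      rwa [Int.cast_neg, sub_neg_eq_add]
  · intro u I x y hI _ hy h hxy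
    obtain ⟨a, b, ha, hb, hab⟩ := exists_sub_mem_of_mul_map_eq hM hσ hP hin hI hy h hxy
    rw [← Ideal.Quotient.eq, map_mul, map_pow, map_pow] at hab
    have ha0 : Ideal.Quotient.mk P a ≠ 0 := fun h => ha (Ideal.Quotient.eq_zero_iff_mem.1 h)
    have hb0 : Ideal.Quotient.mk P b ≠ 0 := fun h => hb (Ideal.Quotient.eq_zero_iff_mem.1 h)
    refine ⟨Units.mk0 _ ha0 / Units.mk0 _ hb0, Units.ext ?_⟩
    change (((Units.mk0 _ ha0 / Units.mk0 _ hb0) ^ 2 : (𝓞 M ⧸ P)ˣ) : 𝓞 M ⧸ P) = r u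
    rw [Units.val_pow_eq_pow_val, Units.val_div_eq_div_val, Units.val_mk0, Units.val_mk0, div_pow,
      hab, mul_div_assoc, div_self (pow_ne_zero 2 hb0), mul_one]
    rfl
  · have hS : (S₁ ∪ S₂).card ≤ 2 := (Finset.card_union_le _ _).trans (by omega)
    have : Algebra.IsQuadraticExtension K M := ⟨hM⟩
    have hrank : Units.rank M = 2 * Units.rank K + 1 := by
      have h1 := IsUnramifiedAtInfinitePlaces.card_infinitePlace K M
      have h2 : 0 < Fintype.card (InfinitePlace K) := Fintype.card_pos
      rw [hM] at h1
      rw [Units.rank, Units.rank]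
      omega
    rw [hrank]
    calc 2 ^ ((S₁ ∪ S₂).card + 2 * Units.rank K) ≤ 2 ^ (2 + 2 * Units.rank K) :=
          Nat.pow_le_pow_right two_pos (by omega)
      _ = 2 * 2 ^ (2 * Units.rank K + 1) := by ring
      _ ≤ T.index * 2 ^ (2 * Units.rank K + 1) := Nat.mul_le_mul_right _ (by omega)

end Octic

theorem IsCyclic.exists_pow_eq_of_pow_eq_one {G : Type*} [Group G] [IsCyclic G] [Finite G]
    {m n : ℕ} (h : Nat.card G = m * n) (hn : 0 < n) {x : G} (hx : x ^ n = 1) :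
    ∃ y : G, y ^ m = x := by
  obtain ⟨g, hg⟩ := IsCyclic.exists_ofOrder_eq_natCard (α := G)
  have hgen : x ∈ Subgroup.zpowers g := by
    rw [Subgroup.eq_top_of_card_eq (Subgroup.zpowers g) (by rw [Nat.card_zpowers, hg])]
    exact Subgroup.mem_top x
  rw [← mem_powers_iff_mem_zpowers] at hgen
  obtain ⟨i, rfl⟩ := hgen
  have hd : m * n ∣ i * n := by
    rw [← h, ← hg]
    exact orderOf_dvd_of_pow_eq_one (by simpa only [pow_mul] using hx)
  obtain ⟨j, rfl⟩ := Nat.dvd_of_mul_dvd_mul_right hn hd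
  exact ⟨g ^ j, by rw [← pow_mul, mul_comm]⟩

section Cyclotomic

variable {F N : Type*} [Field F] [NumberField F] [Field N] [NumberField N] [Algebra F N]
  {p : ℕ}

theorem isCyclic_galois_of_isCyclotomicExtension (hp : p.Prime) [IsCyclotomicExtension {p} ℚ N] :
    IsCyclic Gal(N/ℚ) := by
  have := Fact.mk hp
  have : IsCyclic (ZMod p)ˣ := inferInstance
  let e := IsCyclotomicExtension.autEquivPow (K := ℚ) N
    (Polynomial.cyclotomic.irreducible_rat hp.pos)
  exact isCyclic_of_surjective e.symm e.symm.surjective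

theorem finrank_eq_sub_one_of_isCyclotomicExtension (hp : p.Prime)
    [IsCyclotomicExtension {p} ℚ N] : Module.finrank ℚ N = p - 1 := by
  have : NeZero p := ⟨hp.ne_zero⟩
  rw [IsCyclotomicExtension.finrank (n := p) N (Polynomial.cyclotomic.irreducible_rat hp.pos),
    Nat.totient_prime hp]

theorem exists_sq_eq_prime_of_isCyclotomicExtension (hp : p.Prime) (hp4 : p % 4 = 1)
    [IsCyclotomicExtension {p} ℚ N] : ∃ t : N, t ^ 2 = p := by
  have := Fact.mk hp
  have hζ := IsCyclotomicExtension.zeta_spec p ℚ N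
  have hp2 : ringChar (ZMod p) ≠ 2 := by rw [ZMod.ringChar_zmod_n]; omega
  have h := gaussSum_sq (R' := N) (χ := (quadraticChar (ZMod p)).ringHomComp (Int.castRingHom N))
    ?_ ((quadraticChar_isQuadratic (ZMod p)).comp _)
    (AddChar.zmodChar_primitive_of_primitive_root p hζ)
  · refine ⟨_, h.trans ?_⟩
    rw [MulChar.ringHomComp_apply, quadraticChar_neg_one hp2, ZMod.card]
    rw [ZMod.χ₄_nat_one_mod_four hp4]; simp
  · rw [MulChar.ne_one_iff]
    obtain ⟨a, ha⟩ := quadraticChar_exists_neg_one' hp2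
    refine ⟨a, ?_⟩
    rw [MulChar.ringHomComp_apply, ha]
    norm_num

variable (hF : Module.finrank ℚ F = 4)

include hF

theorem exists_pow_four_eq_restrictScalars [IsGalois ℚ N] [IsCyclic Gal(N/ℚ)] {x : Gal(N/ℚ)}
    (hx : x ^ Module.finrank F N = 1) : ∃ y : Gal(N/ℚ), y ^ 4 = x := by
  refine IsCyclic.exists_pow_eq_of_pow_eq_one ?_ Module.finrank_pos hx
  rw [IsGalois.card_aut_eq_finrank, ← hF, Module.finrank_mul_finrank]

theorem exists_sq_eq_prime_of_finrank_eq_four (hp : p.Prime) (hp4 : p % 4 = 1)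
    [hN : IsCyclotomicExtension {p} ℚ N] : ∃ t : F, t ^ 2 = p := by
  have := IsCyclotomicExtension.isGalois {p} ℚ N
  have := isCyclic_galois_of_isCyclotomicExtension (N := N) hp
  obtain ⟨t, ht⟩ := exists_sq_eq_prime_of_isCyclotomicExtension (N := N) hp hp4
  have hg : ∀ g : Gal(N/ℚ), g t = t ∨ g t = -t := by
    intro g
    rw [← sq_eq_sq_iff_eq_or_eq_neg, ← map_pow, ht, map_natCast]
  have hg2 : ∀ g : Gal(N/ℚ), (g ^ 2) t = t := by
    intro g
    rw [pow_two, AlgEquiv.mul_apply]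
    rcases hg g with h | h
    · rw [h, h]
    · rw [h, map_neg, h, neg_neg]
  have : IsGalois F N := IsGalois.tower_top_of_isGalois ℚ F N
  obtain ⟨u, hu⟩ := (IsGalois.mem_range_algebraMap_iff_fixed (F := F) t).2 fun f => by
    obtain ⟨y, hy⟩ := exists_pow_four_eq_restrictScalars (F := F) hF
      (x := AlgEquiv.restrictScalarsHom ℚ f) (by
        rw [← map_pow, ← IsGalois.card_aut_eq_finrank, pow_card_eq_one', map_one])
    change (AlgEquiv.restrictScalarsHom ℚ f) t = t
    rw [← hy, show 4 = 2 * 2 from rfl, pow_mul]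
    exact hg2 _
  refine ⟨u, (algebraMap F N).injective ?_⟩
  rw [map_pow, hu, ht, map_natCast]

theorem conj_apply_eq_self_of_finrank_eq_four (hp : p.Prime) (hp8 : p % 8 = 1)
    [hN : IsCyclotomicExtension {p} ℚ N] (φ : F →+* ℂ) (x : F) :
    starRingEnd ℂ (φ x) = φ x := by
  have := IsCyclotomicExtension.isGalois {p} ℚ N
  have := isCyclic_galois_of_isCyclotomicExtension (N := N) hp
  have hn : Module.finrank ℚ F * Module.finrank F N = p - 1 := by
    rw [Module.finrank_mul_finrank, finrank_eq_sub_one_of_isCyclotomicExtension hp]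
  set φN := ComplexEmbedding.lift N φ with hφN
  have hlift : ∀ y, φN (algebraMap F N y) = φ y := fun y =>
    RingHom.congr_fun (ComplexEmbedding.lift_comp_algebraMap N φ) y
  obtain ⟨κ, hκ⟩ := ComplexEmbedding.exists_comp_symm_eq_of_comp_eq (k := ℚ) φN
    (ComplexEmbedding.conjugate φN) (Subsingleton.elim _ _)
  have hκ' : ∀ y, φN (κ.symm y) = starRingEnd ℂ (φN y) := fun y => RingHom.congr_fun hκ y
  have hκ2 : κ⁻¹ ^ Module.finrank F N = 1 := by
    have h2 : κ⁻¹ ^ 2 = 1 := by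
      ext y
      apply φN.injective
      rw [pow_two, AlgEquiv.mul_apply, AlgEquiv.one_apply]
      change φN (κ.symm (κ.symm y)) = _
      rw [hκ', hκ', Complex.conj_conj]
    rw [hF] at hn
    obtain ⟨m, hm⟩ : 2 ∣ Module.finrank F N := by omega
    rw [hm, pow_mul, h2, one_pow]
  obtain ⟨y, hy⟩ := exists_pow_four_eq_restrictScalars (F := F) hF hκ2
  have := IsAbelianGalois.of_isCyclic ℚ N
  have : IsAbelianGalois ℚ F := IsAbelianGalois.tower_bot ℚ F N
  have hr : (y.restrictNormal F) ^ 4 = 1 := by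
    rw [← hF, ← IsGalois.card_aut_eq_finrank, pow_card_eq_one']
  have h4 : (κ⁻¹) (algebraMap F N x) = algebraMap F N x := by
    have h5 : (y ^ 4).restrictNormal F = 1 := by
      rw [← hr]
      exact map_pow (AlgEquiv.restrictNormalHom F) y 4
    rw [← hy, ← AlgEquiv.restrictNormal_commutes, h5, AlgEquiv.one_apply]
  rw [← hlift, ← hκ']
  exact congrArg φN h4

end Cyclotomic

section Cyclotomic

variable {F N : Type*} [Field F] [NumberField F] [Field N] [NumberField N] [Algebra F N]
  {p : ℕ}

theorem eq_one_of_apply_eq_of_isPrimitiveRoot (hp : p.Prime) [IsCyclotomicExtension {p} ℚ N]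
    {ζ : N} (hζ : IsPrimitiveRoot ζ p) {g : Gal(N/ℚ)} (hg : g ζ = ζ) : g = 1 := by
  have : NeZero p := ⟨hp.ne_zero⟩
  have h := AlgHom.ext_of_adjoin_eq_top
    (IsCyclotomicExtension.adjoin_primitive_root_eq_top (A := ℚ) hζ)
    (φ₁ := (g : N →ₐ[ℚ] N)) (φ₂ := AlgHom.id ℚ N) (by rintro _ rfl; exact hg)
  exact AlgEquiv.ext fun x => DFunLike.congr_fun h x

theorem natCast_mem_of_forall_conj_sub_mem (hp : p.Prime) [IsCyclotomicExtension {p} ℚ N]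
    {τ : F ≃ₐ[ℚ] F} (hτ : τ ≠ 1) {P : Ideal (𝓞 F)} (hP : P.IsMaximal)
    (hin : ∀ x, ringOfIntegersConj τ x - x ∈ P) : (p : 𝓞 F) ∈ P := by
  classical
  have : NeZero p := ⟨hp.ne_zero⟩
  have := IsCyclotomicExtension.isGalois {p} ℚ N
  have : IsGalois F N := IsGalois.tower_top_of_isGalois ℚ F N
  obtain ⟨Q, hQ, hQP⟩ := Ideal.exists_ideal_over_maximal_of_isIntegral (S := 𝓞 N) P
    (by rw [(RingHom.injective_iff_ker_eq_bot _).1 (FaithfulSMul.algebraMap_injective (𝓞 F) (𝓞 N))]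
        exact bot_le)
  have hζ := IsCyclotomicExtension.zeta_spec p ℚ N
  set z : 𝓞 N := hζ.toInteger with hz
  have hzp : z ^ p = 1 := hζ.toInteger_isPrimitiveRoot.pow_eq_one
  have hzz : z ^ (p - 1) * z = 1 := by
    rw [← pow_succ, Nat.sub_add_cancel hp.one_le, hzp]
  have hsum : ∀ g : Gal(N/ℚ), ∑ b ∈ Finset.range p, (z ^ (p - 1) * ringOfIntegersConj g z) ^ b =
      if g = 1 then (p : 𝓞 N) else 0 := by
    intro g
    split_ifs with hg
    · subst hg
      have : ringOfIntegersConj (1 : Gal(N/ℚ)) z = z := rfl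
      simp [this, hzz]
    · set u := z ^ (p - 1) * ringOfIntegersConj g z
      have hu1 : u - 1 ≠ 0 := by
        intro h
        have h1 : ringOfIntegersConj g z = z := by
          calc ringOfIntegersConj g z = z ^ (p - 1) * z * ringOfIntegersConj g z := by
                rw [hzz, one_mul]
            _ = u * z := by ring
            _ = z := by rw [sub_eq_zero.1 h, one_mul]
        exact hg (eq_one_of_apply_eq_of_isPrimitiveRoot hp hζ (congrArg (algebraMap (𝓞 N) N) h1))
      have hup : u ^ p = 1 := by
        rw [mul_pow, ← map_pow, hzp, map_one, mul_one, ← pow_mul, mul_comm, pow_mul, hzp, one_pow]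
      refine (mul_eq_zero_iff_left hu1).1 ?_
      rw [mul_geom_sum, hup, sub_self]
  have hη : ∀ b : ℕ, ∃ y : 𝓞 F, algebraMap (𝓞 F) (𝓞 N) y =
      ∑ h : Gal(N/F), ringOfIntegersConj h z ^ b := by
    intro b
    refine exists_algebraMap_eq_of_forall_conj_eq fun g => ?_
    rw [map_sum]
    refine Fintype.sum_equiv (Equiv.mulLeft g) _ _ fun h => ?_
    rw [map_pow]; rfl
  choose η hη using hη
  have hγ : ∀ x : 𝓞 F, algebraMap (𝓞 F) (𝓞 N) (ringOfIntegersConj τ x) =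
      ringOfIntegersConj (τ.liftNormal N) (algebraMap (𝓞 F) (𝓞 N) x) := fun x =>
    RingOfIntegers.ext (τ.liftNormal_commutes N x).symm
  have hmem : ∑ b ∈ Finset.range p, (z ^ (p - 1)) ^ b *
      algebraMap (𝓞 F) (𝓞 N) (ringOfIntegersConj τ (η b) - η b) ∈ Q :=
    Q.sum_mem fun b _ => Q.mul_mem_left _ (by
      rw [← Ideal.mem_comap, hQP]; exact hin _)
  have hsum' : ∀ g : Gal(N/ℚ), ∑ b ∈ Finset.range p, (z ^ (p - 1)) ^ b *
      ∑ h : Gal(N/F), ringOfIntegersConj g (ringOfIntegersConj h z) ^ b =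
      ∑ h : Gal(N/F), if g * AlgEquiv.restrictScalars ℚ h = 1 then (p : 𝓞 N) else 0 := by
    intro g
    simp_rw [Finset.mul_sum]
    rw [Finset.sum_comm]
    refine Finset.sum_congr rfl fun h _ => ?_
    rw [← hsum]
    refine Finset.sum_congr rfl fun b _ => ?_
    rw [mul_pow]; rfl
  have h1 := hsum' 1
  have h2 := hsum' (τ.liftNormal N)
  rw [Finset.sum_eq_zero (s := (Finset.univ : Finset Gal(N/F)))] at h2
  · rw [Finset.sum_eq_single (M := 𝓞 N) (s := (Finset.univ : Finset Gal(N/F))) 1] at h1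
    · have h3 : ∑ b ∈ Finset.range p, (z ^ (p - 1)) ^ b *
          algebraMap (𝓞 F) (𝓞 N) (ringOfIntegersConj τ (η b) - η b) = -(p : 𝓞 N) := by
        rw [if_pos (show (1 : Gal(N/ℚ)) * AlgEquiv.restrictScalars ℚ (1 : Gal(N/F)) = 1
          from rfl)] at h1
        rw [← zero_sub, ← h1, ← h2, ← Finset.sum_sub_distrib]
        refine Finset.sum_congr rfl fun b _ => ?_
        rw [map_sub, hγ, hη, map_sum, mul_sub]
        simp_rw [map_pow]
        rfl
      rw [h3, neg_mem_iff] at hmem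
      rwa [← hQP, Ideal.mem_comap, map_natCast]
    · intro h _ hh
      refine if_neg fun h4 => hh ?_
      rw [one_mul] at h4
      exact AlgEquiv.ext fun x => DFunLike.congr_fun h4 x
    · exact fun h => absurd (Finset.mem_univ _) h
  · intro h _
    refine if_neg fun h4 => hτ ?_
    ext x
    apply (algebraMap F N).injective
    have h5 := DFunLike.congr_fun h4 (algebraMap F N x)
    rw [AlgEquiv.mul_apply] at h5
    rw [← τ.liftNormal_commutes N]
    have h6 : AlgEquiv.restrictScalars ℚ h (algebraMap F N x) = algebraMap F N x := h.commutes x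
    rwa [h6] at h5

omit [NumberField F] [NumberField N] in
theorem dvd_of_algebraMap_dvd {x y : 𝓞 F} (hx : x ≠ 0)
    (h : algebraMap (𝓞 F) (𝓞 N) x ∣ algebraMap (𝓞 F) (𝓞 N) y) : x ∣ y := by
  obtain ⟨w, hw⟩ := h
  have hx' : (algebraMap (𝓞 F) F x) ≠ 0 := RingOfIntegers.coe_ne_zero_iff.2 hx
  have hw' : algebraMap F N (algebraMap (𝓞 F) F y / algebraMap (𝓞 F) F x) = w := by
    have h1 : algebraMap F N (algebraMap (𝓞 F) F y) =
        algebraMap F N (algebraMap (𝓞 F) F x) * w := congrArg (algebraMap (𝓞 N) N) hw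
    rw [map_div₀, h1, mul_div_cancel_left₀]
    exact (map_ne_zero _).2 hx'
  have h_int : IsIntegral ℤ (algebraMap (𝓞 F) F y / algebraMap (𝓞 F) F x) := by
    rw [← isIntegral_algebraMap_iff (algebraMap F N).injective, hw']
    exact RingOfIntegers.isIntegral_coe w
  refine ⟨⟨_, h_int⟩, RingOfIntegers.ext ?_⟩
  change algebraMap (𝓞 F) F y =
    algebraMap (𝓞 F) F x * (algebraMap (𝓞 F) F y / algebraMap (𝓞 F) F x)
  rw [mul_div_cancel₀ _ hx']

theorem exists_pow_finrank_eq_prime_mul_unit (hp : p.Prime) [IsCyclotomicExtension {p} ℚ N] :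
    ∃ (η : 𝓞 F) (v : (𝓞 F)ˣ), η ^ Module.finrank ℚ F = p * v := by
  have := Fact.mk hp
  have := IsCyclotomicExtension.isGalois {p} ℚ N
  have : IsGalois F N := IsGalois.tower_top_of_isGalois ℚ F N
  have hζ := IsCyclotomicExtension.zeta_spec p ℚ N
  set z : 𝓞 N := hζ.toInteger with hz
  obtain ⟨η, hη⟩ : ∃ y : 𝓞 F, algebraMap (𝓞 F) (𝓞 N) y =
      ∏ h : Gal(N/F), ringOfIntegersConj h (z - 1) := by
    refine exists_algebraMap_eq_of_forall_conj_eq fun g => ?_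
    rw [map_prod]
    exact Fintype.prod_equiv (Equiv.mulLeft g) _ _ fun h => rfl
  have h1 : Associated (algebraMap (𝓞 F) (𝓞 N) η) ((z - 1) ^ Module.finrank F N) := by
    rw [hη, ← IsGalois.card_aut_eq_finrank, Nat.card_eq_fintype_card, ← Finset.card_univ,
      ← Finset.prod_const]
    refine Associated.prod _ _ _ fun h _ => ?_
    have hh : IsPrimitiveRoot (h (IsCyclotomicExtension.zeta p ℚ N)) p :=
      hζ.map_of_injective h.injective
    have := (IsCyclotomicExtension.Rat.associated_sub_one_of_isPrimitiveRoot p hζ hh).symm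
    rw [map_sub, map_one]
    exact this
  have h2 : Associated (algebraMap (𝓞 F) (𝓞 N) (η ^ Module.finrank ℚ F))
      (algebraMap (𝓞 F) (𝓞 N) p) := by
    rw [map_pow, map_natCast]
    refine (h1.pow_pow).trans ?_
    rw [← pow_mul, mul_comm, Module.finrank_mul_finrank,
      finrank_eq_sub_one_of_isCyclotomicExtension hp]
    exact IsCyclotomicExtension.Rat.associated_zeta_sub_one_pow_prime p hζ
  have hp0 : (p : 𝓞 F) ≠ 0 := Nat.cast_ne_zero.2 hp.ne_zero
  have hη0 : η ^ Module.finrank ℚ F ≠ 0 := by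
    intro h0
    rw [h0, map_zero] at h2
    exact hp0 ((map_eq_zero_iff _ (FaithfulSMul.algebraMap_injective (𝓞 F) (𝓞 N))).1
      (associated_zero_iff_eq_zero _ |>.1 h2.symm))
  obtain ⟨v, hv⟩ := associated_of_dvd_dvd (dvd_of_algebraMap_dvd hp0 h2.dvd')
    (dvd_of_algebraMap_dvd hη0 h2.dvd)
  exact ⟨η, v, hv.symm⟩

end Cyclotomic

section Compositum

variable {k K M F N : Type*} [Field k] [NumberField k] [Field K] [NumberField K] [Field M]
  [NumberField M] [Field F] [NumberField F] [Field N] [NumberField N] [Algebra k K] [Algebra K M]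
  [Algebra F M] [Algebra F N]

omit [NumberField K] [NumberField M] [NumberField F] in
theorem isUnramifiedAtInfinitePlaces_of_forall_conj_apply_eq [IsGalois K M]
    (hreal : ∀ (φ : F →+* ℂ) (x : F), starRingEnd ℂ (φ x) = φ x)
    (hgen : ∀ σ : M ≃ₐ[K] M, (∀ x, σ (algebraMap F M x) = algebraMap F M x) → σ = 1) :
    IsUnramifiedAtInfinitePlaces K M := by
  refine ⟨fun w => by_contra fun hw => ?_⟩
  have hram : InfinitePlace.IsRamified K (InfinitePlace.mk w.embedding) := by
    rwa [InfinitePlace.mk_embedding]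
  obtain ⟨σ, hσ⟩ := InfinitePlace.exists_isConj_of_isRamified hram
  have hσ1 : σ = 1 := by
    refine hgen σ fun x => w.embedding.injective ?_
    rw [hσ.eq]
    exact hreal (w.embedding.comp (algebraMap F M)) x
  rw [hσ1, ComplexEmbedding.isConj_one_iff] at hσ
  exact (InfinitePlace.not_isReal_iff_isComplex.2 hram.isComplex)
    (InfinitePlace.isReal_mk_iff.2 hσ)

theorem odd_classNumber_of_finrank_eq_four (hk : Module.finrank ℚ k = 2)
    (hK : Module.finrank k K = 2) (hM : Module.finrank K M = 2) {p : ℕ} (hp : p.Prime)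
    (hp16 : p % 16 = 9) {s : 𝓞 k} (hs : s ^ 2 = p) {ε : (𝓞 k)ˣ}
    (hnorm : Algebra.norm ℚ ((ε : 𝓞 k) : k) = -1) (ψ : k →+* ℝ) (hψ : 0 < ψ ((ε : 𝓞 k) : k))
    {θ : 𝓞 K} (hθ : θ ^ 2 = algebraMap (𝓞 k) (𝓞 K) ε) [IsCyclotomicExtension {p} ℚ N]
    (hF : Module.finrank ℚ F = 4)
    (hgen : ∀ σ : M ≃ₐ[K] M, (∀ x, σ (algebraMap F M x) = algebraMap F M x) → σ = 1) :
    Odd (classNumber M) := by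
  have : Algebra.IsQuadraticExtension K M := ⟨hM⟩
  have := isUnramifiedAtInfinitePlaces_of_forall_conj_apply_eq
    (conj_apply_eq_self_of_finrank_eq_four (N := N) hF hp (by omega)) hgen
  obtain ⟨σ, hσ⟩ := exists_algEquiv_ne_one_of_finrank_eq_two hM
  obtain ⟨η, v, hη⟩ := exists_pow_finrank_eq_prime_mul_unit (F := F) (N := N) hp
  rw [hF] at hη
  have : IsGalois ℚ N := IsCyclotomicExtension.isGalois {p} ℚ N
  have := isCyclic_galois_of_isCyclotomicExtension (N := N) hp
  have := IsAbelianGalois.of_isCyclic ℚ N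
  have : IsAbelianGalois ℚ F := IsAbelianGalois.tower_bot ℚ F N
  let τ : F ≃ₐ[ℚ] F := (σ.restrictScalars ℚ).restrictNormal F
  have hτσ : ∀ x, algebraMap F M (τ x) = σ (algebraMap F M x) := fun x =>
    (σ.restrictScalars ℚ).restrictNormal_commutes F x
  have hτ : τ ≠ 1 := fun h => hσ <| hgen σ fun x => by rw [← hτσ, h, AlgEquiv.one_apply]
  refine odd_classNumber_of_pow_four_eq hk hK hM hp hp16 hs hnorm ψ hψ hθ hσ ?_
    (η := algebraMap (𝓞 F) (𝓞 M) η) (v := Units.map (algebraMap (𝓞 F) (𝓞 M)).toMonoidHom v) ?_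
  · intro P hP hin
    have hmem := natCast_mem_of_forall_conj_sub_mem (N := N) hp hτ
      (P := P.comap (algebraMap (𝓞 F) (𝓞 M)))
      (Ideal.isMaximal_comap_of_isIntegral_of_isMaximal P) fun x => by
        rw [Ideal.mem_comap, map_sub]
        convert hin (algebraMap (𝓞 F) (𝓞 M) x) using 2
        apply RingOfIntegers.coe_injective
        exact hτσ x
    rw [Ideal.mem_comap, map_natCast] at hmem
    exact hmem
  · rw [← map_pow, hη, map_mul, map_natCast]
    rfl

end Compositum

theorem finrank_adjoin_simple_eq_two {K L : Type*} [Field K] [Field L] [Algebra K L] {x : L} {d : K}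
    (hx : x ^ 2 = algebraMap K L d) (hxK : x ∉ Set.range (algebraMap K L)) :
    Module.finrank K K⟮x⟯ = 2 := by
  have h_int : IsIntegral K x := ⟨Polynomial.X ^ 2 - Polynomial.C d,
    Polynomial.monic_X_pow_sub_C d two_ne_zero, by simp [hx]⟩
  rw [adjoin.finrank h_int]
  refine le_antisymm ?_ ((minpoly.two_le_natDegree_iff h_int).2 hxK)
  rw [← Polynomial.natDegree_X_pow_sub_C (n := 2) (r := d)]
  exact Polynomial.natDegree_le_of_dvd (minpoly.dvd K x (by simp [hx]))
    (Polynomial.monic_X_pow_sub_C d two_ne_zero).ne_zero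

/-- If every complex embedding of a field `F` is real, no element of `F` squares to a quadratic
unit of norm `-1` in `F`, provided this unit is positive in the given embedding. -/
theorem sq_ne_of_norm_eq_neg_one {k F : Type*} [Field k] [NumberField k] [Field F] [NumberField F]
    [Algebra k F] (hk : Module.finrank ℚ k = 2)
    (hreal : ∀ (φ : F →+* ℂ) (x : F), starRingEnd ℂ (φ x) = φ x) {ε : k}
    (hnorm : Algebra.norm ℚ ε = -1) (ψ : k →+* ℝ) (hψ : 0 < ψ ε) (u : F) :
    u ^ 2 ≠ algebraMap k F ε := by
  intro hu
  obtain ⟨τ, hτ⟩ := exists_algEquiv_ne_one_of_finrank_eq_two hk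
  have hmul := algebraNorm_eq_mul_of_finrank_eq_two hk hτ ε
  rw [hnorm, map_neg, map_one] at hmul
  let φ := ComplexEmbedding.lift F ((Complex.ofRealHom.comp ψ).comp τ.toAlgHom.toRingHom)
  have hφ : φ u ^ 2 = (ψ (τ ε) : ℂ) := by
    rw [← map_pow, hu]
    exact RingHom.congr_fun (ComplexEmbedding.lift_comp_algebraMap F _) ε
  obtain ⟨r, hr⟩ := Complex.conj_eq_iff_real.1 (hreal φ u)
  rw [hr] at hφ
  have h1 : r ^ 2 = ψ (τ ε) := by exact_mod_cast hφ
  have h2 := congrArg ψ hmul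
  rw [map_neg, map_one, map_mul, ← h1] at h2
  nlinarith [mul_nonneg hψ.le (sq_nonneg r)]

/-- **Theorem 10 (Lemmermeyer), main step.**  Let `p` be a prime with `p ≡ 9 (mod 16)`,
`k = ℚ(√p)` (inside `ℂ`), `F` the quartic subfield of `ℚ(μ_p)` (inside `ℂ`), and `ε` a unit of
the ring of integers of `k` which is positive in the real embedding sending `√p` to the
positive square root, with `N_{k/ℚ}(ε) = −1`.  Then the class number of `F(√ε)` is odd. -/
theorem classNumber_quartic_subfield_adjoin_sqrt_unit_odd
    (p : ℕ) (hp : p.Prime) (hp16 : p % 16 = 9)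
    (k : IntermediateField ℚ ℂ) (hk : k = ℚ⟮(Real.sqrt p : ℂ)⟯) [NumberField k]
    (ε : (𝓞 k)ˣ)
    (hεpos : ∃ r : ℝ, 0 < r ∧ (((ε : 𝓞 k) : k) : ℂ) = r)
    (hεnorm : Algebra.norm ℚ ((ε : 𝓞 k) : k) = -1)
    (ζ : ℂ) (hζ : IsPrimitiveRoot ζ p)
    (F : IntermediateField ℚ ℂ) (hFle : F ≤ ℚ⟮ζ⟯) (hF4 : Module.finrank ℚ F = 4)
    (c : ℂ) (hc : c ^ 2 = (((ε : 𝓞 k) : k) : ℂ))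
    (Fε : IntermediateField F ℂ) (hFε : Fε = IntermediateField.adjoin F {c})
    [NumberField Fε] :
    Odd (NumberField.classNumber Fε) := by
  have : NeZero p := ⟨hp.ne_zero⟩
  have hsq : ((Real.sqrt p : ℝ) : ℂ) ^ 2 = p := by
    rw [← Complex.ofReal_pow, Real.sq_sqrt p.cast_nonneg, Complex.ofReal_natCast]
  have hsk : (Real.sqrt p : ℂ) ∈ k := hk ▸ mem_adjoin_simple_self ℚ _
  have h_int : IsIntegral ℤ (⟨(Real.sqrt p : ℂ), hsk⟩ : k) :=
    ⟨Polynomial.X ^ 2 - Polynomial.C (p : ℤ), Polynomial.monic_X_pow_sub_C _ two_ne_zero, by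
      simp [Subtype.ext_iff, hsq]⟩
  obtain ⟨s, hs⟩ : ∃ s : 𝓞 k, ((s : k) : ℂ) = (Real.sqrt p : ℂ) := ⟨⟨_, h_int⟩, rfl⟩
  have hs2 : (s : k) ^ 2 = p := Subtype.ext (by push_cast; rw [hs, hsq])
  have hk2 : Module.finrank ℚ k = 2 := by
    rw [hk]
    refine finrank_adjoin_simple_eq_two (d := (p : ℚ)) (by simpa using hsq) ?_
    rintro ⟨q, hq⟩
    exact notMem_range_of_sq_eq_prime hp hs2 ⟨q, Subtype.ext (by rw [hs, ← hq]; rfl)⟩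
  have : IsCyclotomicExtension {p} ℚ ℚ⟮ζ⟯ := by
    change IsCyclotomicExtension {p} ℚ ℚ⟮ζ⟯.toSubalgebra
    rw [adjoin_simple_toSubalgebra_of_isAlgebraic (hζ.isIntegral hp.pos).tower_top.isAlgebraic]
    exact hζ.adjoin_isCyclotomicExtension ℚ
  have : NumberField ℚ⟮ζ⟯ := IsCyclotomicExtension.numberField {p} ℚ _
  have : FiniteDimensional ℚ F := FiniteDimensional.of_finrank_pos (by omega)
  have : NumberField F := ⟨⟩
  let _ : Algebra F ℚ⟮ζ⟯ := (inclusion hFle).toRingHom.toAlgebra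
  have hreal := conj_apply_eq_self_of_finrank_eq_four (N := ℚ⟮ζ⟯) hF4 hp (by omega)
  obtain ⟨t, ht⟩ := exists_sq_eq_prime_of_finrank_eq_four (N := ℚ⟮ζ⟯) hF4 hp (by omega)
  have hkF : k ≤ F := by
    rw [hk, adjoin_simple_le_iff]
    have ht' : (t : ℂ) ^ 2 = p := by exact_mod_cast congrArg (Subtype.val) ht
    rcases sq_eq_sq_iff_eq_or_eq_neg.1 (hsq.trans ht'.symm) with h | h
    · exact h ▸ t.2
    · exact h ▸ neg_mem t.2
  let _ : Algebra k F := (inclusion hkF).toRingHom.toAlgebra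
  have hkreal : ComplexEmbedding.IsReal k.val.toRingHom :=
    RingHom.ext fun x => hreal F.val.toRingHom (inclusion hkF x)
  let ψ : k →+* ℝ := hkreal.embedding
  have hψ : 0 < ψ ((ε : 𝓞 k) : k) := by
    obtain ⟨r, hr, hεr⟩ := hεpos
    have h : ((ψ ((ε : 𝓞 k) : k) : ℝ) : ℂ) = r :=
      (hkreal.coe_embedding_apply _).trans hεr
    rwa [Complex.ofReal_injective h]
  have hK2 : Module.finrank k k⟮c⟯ = 2 := finrank_adjoin_simple_eq_two hc
    (notMem_range_of_sq_eq_of_norm_eq_neg_one hεnorm hc)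
  have hcF : c ∉ Set.range (algebraMap F ℂ) := by
    rintro ⟨u, rfl⟩
    exact sq_ne_of_norm_eq_neg_one hk2 hreal hεnorm ψ hψ u (Subtype.ext hc)
  have hF2 : Module.finrank F Fε = 2 := by
    rw [hFε]
    exact finrank_adjoin_simple_eq_two
      (d := inclusion hkF ((ε : 𝓞 k) : k)) hc hcF
  have hcFε : c ∈ Fε := hFε ▸ mem_adjoin_simple_self F c
  have hle : ∀ x ∈ k⟮c⟯, x ∈ Fε := by
    intro x hx
    induction hx using adjoin_induction with
    | mem x hx => exact (Set.mem_singleton_iff.1 hx) ▸ hcFε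
    | algebraMap x => exact Fε.algebraMap_mem (inclusion hkF x)
    | add x y _ _ hx hy => exact add_mem hx hy
    | inv x _ hx => exact inv_mem hx
    | mul x y _ _ hx hy => exact mul_mem hx hy
  have : FiniteDimensional k k⟮c⟯ := FiniteDimensional.of_finrank_pos (by omega)
  have : FiniteDimensional ℚ k⟮c⟯ := FiniteDimensional.trans ℚ k k⟮c⟯
  have : NumberField k⟮c⟯ := ⟨⟩
  let _ : Algebra k⟮c⟯ Fε :=
    ((algebraMap k⟮c⟯ ℂ).codRestrict Fε fun x => hle x x.2).toAlgebra
  have hM2 : Module.finrank k⟮c⟯ Fε = 2 := by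
    have h1 := Module.finrank_mul_finrank ℚ k k⟮c⟯
    have h2 := Module.finrank_mul_finrank ℚ F Fε
    have h3 := Module.finrank_mul_finrank ℚ k⟮c⟯ Fε
    rw [hk2, hK2] at h1
    rw [hF4, hF2, ← h3, ← h1] at h2
    omega
  have hcint : IsIntegral ℤ (⟨c, mem_adjoin_simple_self k c⟩ : k⟮c⟯) := by
    refine IsIntegral.of_pow two_pos ?_
    rw [show (⟨c, mem_adjoin_simple_self k c⟩ : k⟮c⟯) ^ 2 =
      algebraMap k k⟮c⟯ ((ε : 𝓞 k) : k) from Subtype.ext hc]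
    exact (RingOfIntegers.isIntegral_coe (ε : 𝓞 k)).algebraMap
  obtain ⟨θ, hθ⟩ : ∃ θ : 𝓞 k⟮c⟯, ((θ : k⟮c⟯) : ℂ) = c :=
    ⟨⟨_, hcint⟩, rfl⟩
  refine odd_classNumber_of_finrank_eq_four (F := F) (N := ℚ⟮ζ⟯) hk2 hK2 hM2 hp hp16 (s := s) ?_
    hεnorm ψ hψ (θ := θ) ?_ hF4 ?_
  · apply RingOfIntegers.coe_injective
    rw [map_pow, map_natCast]
    exact hs2
  · apply RingOfIntegers.coe_injective
    apply Subtype.ext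
    rw [map_pow]
    exact (congrArg (· ^ 2) hθ).trans hc
  · intro σ hσ
    let σF : Fε →ₐ[F] Fε := { σ.toRingEquiv.toRingHom with commutes' := hσ }
    have h : σF = AlgHom.id F Fε := by
      refine algHom_ext_of_finrank_eq_two hF2 (s := (⟨c, hcFε⟩ : Fε)) ?_ ?_
      · rintro ⟨u, hu⟩
        exact hcF ⟨u, congrArg Subtype.val hu⟩
      · exact σ.commutes ⟨c, mem_adjoin_simple_self k c⟩
    exact AlgEquiv.ext fun x => DFunLike.congr_fun h x
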